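/- arXiv:math/0501120 — 7 statements merged into one kernel-verified Lean document; each statement's English description precedes it below -/
import Mathlib

section
/- Let K be a quadratic field with ring of integers 𝓞_K and nontrivial field automorphism σ, let p be a rational prime that is inert in K, and let α ∈ 𝓞_K with p not dividing N(α). Then in the unit group (𝓞_K/p𝓞_K)ˣ, the product of the multiplicative order of σ(α)·α⁻¹ and the multiplicative order of N(α) divides 2 times the multiplicative order of α. -/
set_option synthInstance.maxHeartbeats 1000000
set_option maxHeartbeats 1000000
open NumberField

theorem orderOf_pow_mul_orderOf_pow_dvd {M : Type*} [Monoid M] {x : M} {i j : ℕ}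
    (hi : i ≠ 0) (hj : j ≠ 0) (hx : x ^ (i * j) = 1) :
    orderOf (x ^ i) * orderOf (x ^ j) ∣ orderOf x := by
  have hpos : 0 < orderOf x :=
    orderOf_pos_iff.2 <|
      isOfFinOrder_iff_pow_eq_one.2 ⟨_, Nat.pos_of_ne_zero (mul_ne_zero hi hj), hx⟩
  rw [orderOf_pow' x hi, orderOf_pow' x hj]
  have hdvd : orderOf x ∣ (orderOf x).gcd i * (orderOf x).gcd j := by
    simpa [Nat.gcd_eq_left (orderOf_dvd_of_pow_eq_one hx)] using
      Nat.gcd_mul_right_dvd_mul_gcd (orderOf x) i j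
  rw [Nat.div_mul_div_comm (Nat.gcd_dvd_left _ _) (Nat.gcd_dvd_left _ _)]
  refine (Nat.div_dvd_div_left ?_ hdvd).trans ?_
  · exact mul_dvd_mul (Nat.gcd_dvd_left _ _) (Nat.gcd_dvd_left _ _)
  · rw [Nat.mul_div_cancel _ hpos]

theorem pow_char_eq_or_eq_of_add_mul_eq_intCast {F : Type*} [CommRing F] [IsDomain F]
    {p : ℕ} [Fact p.Prime] [CharP F p] {a b : F} {t n : ℤ} (ht : a + b = t) (hn : a * b = n) :
    a ^ p = a ∨ a ^ p = b := by
  have ht' : a ^ p + b ^ p = a + b := by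
    rw [← add_pow_char, ht]; exact map_intCast (frobenius F p) t
  have hn' : a ^ p * b ^ p = a * b := by
    rw [← mul_pow, hn]; exact map_intCast (frobenius F p) n
  have h : (a ^ p - a) * (a ^ p - b) = 0 := by
    linear_combination a ^ p * ht' - hn'
  simpa [sub_eq_zero] using h

theorem exists_intCast_eq_of_pow_char_eq {F : Type*} [CommRing F] [IsDomain F]
    {p : ℕ} [Fact p.Prime] [CharP F p] {a : F} (ha : a ^ p = a) : ∃ m : ℤ, (m : F) = a := by
  obtain ⟨z, rfl⟩ := (GaloisField.splits_zmod_X_pow_sub_X p).mem_range_of_isRoot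
    (FiniteField.X_pow_card_sub_X_ne_zero (ZMod p) (Fact.out : p.Prime).one_lt)
    (i := ZMod.castHom dvd_rfl F) (x := a) (by simp [ha])
  obtain ⟨m, rfl⟩ := ZMod.intCast_surjective z
  exact ⟨m, (map_intCast _ m).symm⟩

theorem NumberField.RingOfIntegers.exists_intCast_eq_add_and_mul_of_finrank_eq_two
    {K : Type*} [Field K] [NumberField K] (hdeg : Module.finrank ℚ K = 2)
    {σ : 𝓞 K ≃+* 𝓞 K} (hσ : σ ≠ RingEquiv.refl (𝓞 K)) (α : 𝓞 K) :
    ∃ t n : ℤ, α + σ α = t ∧ α * σ α = n := by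
  classical
  have : Algebra.IsQuadraticExtension ℚ K := ⟨hdeg⟩
  let τ : Gal(K/ℚ) := AlgEquiv.ofRingEquiv
    (f := IsFractionRing.ringEquivOfRingEquiv (K := K) (L := K) σ)
    (fun q ↦ map_ratCast _ q)
  have hτσ (x : 𝓞 K) : τ x = σ x := IsFractionRing.ringEquivOfRingEquiv_algebraMap σ x
  have hτ : 1 ≠ τ := by
    intro h
    apply hσ
    ext x
    simp [← hτσ, ← h]
  have huniv : (Finset.univ : Finset Gal(K/ℚ)) = {1, τ} := by
    symm
    rw [← Finset.card_eq_iff_eq_univ, Finset.card_pair hτ, Fintype.card_eq_nat_card,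
      IsGalois.card_aut_eq_finrank, hdeg]
  refine ⟨Algebra.trace ℤ (𝓞 K) α, Algebra.norm ℤ α, ?_, ?_⟩
  · have h := trace_eq_sum_automorphisms (K := ℚ) (α : K)
    rw [huniv, Finset.sum_pair hτ, ← Algebra.coe_trace_int, hτσ] at h
    apply RingOfIntegers.ext
    simpa using h.symm
  · have h := Algebra.norm_eq_prod_automorphisms ℚ (α : K)
    rw [huniv, Finset.prod_pair hτ, ← Algebra.coe_norm_int, hτσ] at h
    apply RingOfIntegers.ext
    simpa using h.symm

/-- Let `K` be a quadratic field with ring of integers `𝓞 K` and nontrivial automorphism `σ`,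
let `p` be a rational prime that is inert in `K`, and `α ∈ 𝓞 K` with `p ∤ N(α) = α·σ α`.
Then in `𝓞 K ⧸ p𝓞 K` one has `ord(σ α · α⁻¹) · ord(N(α)) ∣ 2 · ord(α)`. -/
theorem stmt_4 (K : Type*) [Field K] [NumberField K]
    (hdeg : Module.finrank ℚ K = 2)
    (σ : (𝓞 K) ≃+* (𝓞 K)) (hσ : σ ≠ RingEquiv.refl (𝓞 K))
    (p : ℕ) (hp : p.Prime)
    (hinert : (Ideal.span {(p : 𝓞 K)}).IsPrime)
    (α : 𝓞 K) (hα : ¬ (p : 𝓞 K) ∣ α * σ α) :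
    orderOf (Ideal.Quotient.mk (Ideal.span {(p : 𝓞 K)}) (σ α) *
        Ring.inverse (Ideal.Quotient.mk (Ideal.span {(p : 𝓞 K)}) α)) *
      orderOf (Ideal.Quotient.mk (Ideal.span {(p : 𝓞 K)}) (α * σ α)) ∣
    2 * orderOf (Ideal.Quotient.mk (Ideal.span {(p : 𝓞 K)}) α) := by
  have : Fact p.Prime := ⟨hp⟩
  set π := Ideal.Quotient.mk (Ideal.span {(p : 𝓞 K)}) with hπ
  have hker (x : 𝓞 K) : π x = 0 ↔ (p : 𝓞 K) ∣ x := by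
    rw [hπ, Ideal.Quotient.eq_zero_iff_dvd]
  have : CharP (𝓞 K ⧸ Ideal.span {(p : 𝓞 K)}) p :=
    (CharP.charP_iff_prime_eq_zero hp).2 (by rw [← map_natCast π, hker])
  obtain ⟨t, n, ht, hn⟩ :=
    RingOfIntegers.exists_intCast_eq_add_and_mul_of_finrank_eq_two hdeg hσ α
  replace ht : π α + π (σ α) = t := by rw [← map_add, ht, map_intCast]
  replace hn : π α * π (σ α) = n := by rw [← map_mul, hn, map_intCast]
  have hfrob : π α ^ p = π (σ α) := by
    rcases pow_char_eq_or_eq_of_add_mul_eq_intCast (p := p) ht hn with h | h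
    · obtain ⟨m, hm⟩ := exists_intCast_eq_of_pow_char_eq h
      have hdvd : (p : 𝓞 K) ∣ α - m := by
        rw [← hker, map_sub, map_intCast, hm, sub_self]
      have hσdvd : (p : 𝓞 K) ∣ σ α - m := by simpa using map_dvd σ hdvd
      rw [← hker, map_sub, map_intCast, hm, sub_eq_zero] at hσdvd
      rw [h, hσdvd]
    · exact h
  have hne : π α ≠ 0 := fun h ↦ hα ((hker _).1 (by rw [map_mul, h, zero_mul]))
  have hfrob_sq : π α ^ (p * p) = π α := by
    have h : π α ^ p + π (σ α) ^ p = π α + π (σ α) := by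
      rw [← add_pow_char, ht]; exact map_intCast (frobenius _ p) t
    rw [pow_mul]
    rw [hfrob] at h ⊢
    linear_combination h
  obtain ⟨k, rfl⟩ : ∃ k, p = k + 1 := ⟨p - 1, (Nat.sub_add_cancel hp.one_le).symm⟩
  have hk : k ≠ 0 := by rintro rfl; exact hp.ne_one rfl
  have hone : π α ^ (k * (k + 2)) = 1 := by
    apply mul_right_cancel₀ hne
    rw [one_mul, ← pow_succ]
    convert hfrob_sq using 2
    ring
  have hunit : IsUnit (π α) := IsUnit.of_pow_eq_one hone (by positivity)
  rw [map_mul, ← hfrob, ← pow_succ', pow_succ _ k, mul_assoc,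
    Ring.mul_inverse_cancel _ hunit, mul_one]
  exact (orderOf_pow_mul_orderOf_pow_dvd hk (by positivity) hone).mul_left 2
end

section
/- Let K be a quadratic field with ring of integers 𝓞_K and nontrivial field automorphism σ, let p be a rational prime that is inert in K, let α ∈ 𝓞_K with p not dividing N(α), and let e₁, e₂ be positive integers. If the multiplicative order of σ(α)·α⁻¹ in (𝓞_K/p𝓞_K)ˣ is at least (p+1)/e₁ and the multiplicative order of N(α) in (𝓞_K/p𝓞_K)ˣ is at least (p−1)/e₂, then the multiplicative order of α in (𝓞_K/p𝓞_K)ˣ is at least (p²−1)/(2·e₁·e₂). -/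
set_option synthInstance.maxHeartbeats 1000000
set_option maxHeartbeats 1000000

open NumberField

/-- A ring endomorphism of a field with `p ^ 2` elements is the identity or the Frobenius. -/
lemma FiniteField.ringHom_eq_id_or_frobenius_of_card_eq_prime_sq {F : Type*} [Field F] [Finite F] {p : ℕ}
    [Fact p.Prime] (hF : Nat.card F = p ^ 2) (τ : F →+* F) :
    (∀ x, τ x = x) ∨ ∀ x, τ x = x ^ p := by
  have := Fintype.ofFinite F
  have : CharP F p := charP_of_card_eq_prime_pow (f := 2) (by rw [← Nat.card_eq_fintype_card, hF])
  let _ : Algebra (ZMod p) F := ZMod.algebra F p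
  have hrank : Module.finrank (ZMod p) F = 2 := by
    have h := Module.natCard_eq_pow_finrank (K := ZMod p) (V := F)
    rw [hF, Nat.card_zmod] at h
    exact (Nat.pow_right_injective (Fact.out : p.Prime).two_le h).symm
  let τ' : F →ₐ[ZMod p] F :=
    AlgHom.mk τ <| RingHom.congr_fun <|
      RingHom.ext_zmod (τ.comp (algebraMap (ZMod p) F)) (algebraMap (ZMod p) F)
  obtain ⟨⟨i, hi⟩, h⟩ := (FiniteField.bijective_frobeniusAlgHom_pow (ZMod p) F).2 τ'
  rw [hrank] at hi
  have hτ : ∀ x, τ x = (FiniteField.frobeniusAlgHom (ZMod p) F ^ i) x := fun x ↦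
    (DFunLike.congr_fun h x).symm
  interval_cases i
  · exact .inl fun x ↦ by simp [hτ]
  · exact .inr fun x ↦ by simp [hτ, ZMod.card]

/-- For `a ≠ 0` in a field with `p ^ 2` elements and an endomorphism `τ`, the orders of `τ a / a`
and `a * τ a` have a common divisor of at most `2`, so their product divides twice the order
of `a`. -/
lemma orderOf_map_mul_inv_mul_orderOf_mul_map_dvd {F : Type*} [Field F] [Finite F] {p : ℕ}
    [Fact p.Prime] (hF : Nat.card F = p ^ 2) (τ : F →+* F) {a : F} (ha : a ≠ 0) :
    orderOf (τ a * a⁻¹) * orderOf (a * τ a) ∣ 2 * orderOf a := by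
  have hcard : a ^ (p ^ 2 - 1) = 1 := by
    have := Fintype.ofFinite F
    rw [← hF, Nat.card_eq_fintype_card]
    exact FiniteField.pow_card_sub_one_eq_one a ha
  have hp : 1 ≤ p := (Fact.out : p.Prime).one_le
  have hgcd : Nat.gcd (orderOf (τ a * a⁻¹)) (orderOf (a * τ a)) ∣ 2 := by
    rcases FiniteField.ringHom_eq_id_or_frobenius_of_card_eq_prime_sq hF τ with h | h
    · simp [h, ha]
    · have hsq : p ^ 2 - 1 = (p + 1) * (p - 1) := by
        simpa using Nat.sq_sub_sq p 1
      have hquot : τ a * a⁻¹ = a ^ (p - 1) := by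
        rw [h, mul_inv_eq_iff_eq_mul₀ ha, ← pow_succ, Nat.sub_add_cancel hp]
      have hnorm : a * τ a = a ^ (p + 1) := by rw [h, pow_succ']
      have h₁ : orderOf (τ a * a⁻¹) ∣ p + 1 := orderOf_dvd_of_pow_eq_one <| by
        rw [hquot, ← pow_mul, mul_comm, ← hsq, hcard]
      have h₂ : orderOf (a * τ a) ∣ p - 1 := orderOf_dvd_of_pow_eq_one <| by
        rw [hnorm, ← pow_mul, ← hsq, hcard]
      have h₃ := Nat.dvd_sub ((Nat.gcd_dvd_left _ _).trans h₁) ((Nat.gcd_dvd_right _ _).trans h₂)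
      rwa [show p + 1 - (p - 1) = 2 by omega] at h₃
  have hτ : τ a ^ orderOf a = 1 := by rw [← map_pow, pow_orderOf_eq_one, map_one]
  have hlcm : Nat.lcm (orderOf (τ a * a⁻¹)) (orderOf (a * τ a)) ∣ orderOf a :=
    Nat.lcm_dvd
      (orderOf_dvd_of_pow_eq_one <| by rw [mul_pow, inv_pow, hτ, pow_orderOf_eq_one]; simp)
      (orderOf_dvd_of_pow_eq_one <| by rw [mul_pow, hτ, pow_orderOf_eq_one, one_mul])
  rw [← Nat.gcd_mul_lcm]
  exact mul_dvd_mul hgcd hlcm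

/-- Let `K` be a quadratic field with ring of integers `𝓞 K` and nontrivial automorphism `σ`,
let `p` be a rational prime that is inert in `K`, let `α ∈ 𝓞 K` with `p ∤ N(α) = α·σ α`, and
let `e₁, e₂` be positive integers.  If the order of `σ α · α⁻¹` mod `p` is at least
`(p+1)/e₁` and the order of `N(α)` mod `p` is at least `(p-1)/e₂`, then the order of `α`
mod `p` is at least `(p²-1)/(2·e₁·e₂)`. -/
theorem stmt_5 (K : Type*) [Field K] [NumberField K]
    (hdeg : Module.finrank ℚ K = 2)
    (σ : (𝓞 K) ≃+* (𝓞 K)) (hσ : σ ≠ RingEquiv.refl (𝓞 K))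
    (p : ℕ) (hp : p.Prime)
    (hinert : (Ideal.span {(p : 𝓞 K)}).IsPrime)
    (α : 𝓞 K) (hα : ¬ (p : 𝓞 K) ∣ α * σ α)
    (e₁ e₂ : ℕ) (he₁ : 0 < e₁) (he₂ : 0 < e₂)
    (hM : ((p : ℝ) + 1) / e₁ ≤
      orderOf (Ideal.Quotient.mk (Ideal.span {(p : 𝓞 K)}) (σ α) *
        Ring.inverse (Ideal.Quotient.mk (Ideal.span {(p : 𝓞 K)}) α)))
    (hN : ((p : ℝ) - 1) / e₂ ≤
      orderOf (Ideal.Quotient.mk (Ideal.span {(p : 𝓞 K)}) (α * σ α))) :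
    ((p : ℝ) ^ 2 - 1) / (2 * e₁ * e₂) ≤
      orderOf (Ideal.Quotient.mk (Ideal.span {(p : 𝓞 K)}) α) := by
  have : Fact p.Prime := ⟨hp⟩
  set I := Ideal.span {(p : 𝓞 K)} with hI
  have hI0 : I ≠ ⊥ := by
    simpa [hI, Ideal.span_singleton_eq_bot] using hp.ne_zero
  have : I.IsMaximal := hinert.isMaximal hI0
  let _ : Field (𝓞 K ⧸ I) := Ideal.Quotient.field I
  have hcard : Nat.card (𝓞 K ⧸ I) = p ^ 2 := by
    have h := Ideal.absNorm_span_natCast (S := 𝓞 K) p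
    rwa [RingOfIntegers.rank, hdeg, Ideal.absNorm_apply, Submodule.cardQuot_apply] at h
  have hle : I ≤ I.comap (σ : 𝓞 K →+* 𝓞 K) := by
    rw [hI, Ideal.span_singleton_le_iff_mem, Ideal.mem_comap, map_natCast]
    exact Ideal.mem_span_singleton_self _
  let τ : 𝓞 K ⧸ I →+* 𝓞 K ⧸ I := Ideal.quotientMap I (σ : 𝓞 K →+* 𝓞 K) hle
  have hτ : Ideal.Quotient.mk I (σ α) = τ (Ideal.Quotient.mk I α) :=
    (Ideal.quotientMap_mk (f := (σ : 𝓞 K →+* 𝓞 K))).symm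
  have ha : Ideal.Quotient.mk I α ≠ 0 := fun h ↦ hα <| by
    rw [Ideal.Quotient.eq_zero_iff_mem, Ideal.mem_span_singleton] at h
    exact h.mul_right _
  rw [hτ, Ring.inverse_eq_inv] at hM
  rw [map_mul, hτ] at hN
  have hpos : 0 < orderOf (Ideal.Quotient.mk I α) := by
    rw [orderOf_pos_iff]
    exact (Units.coeHom _).isOfFinOrder (isOfFinOrder_of_finite (Units.mk0 _ ha))
  have hdvd := Nat.le_of_dvd (by positivity)
    (orderOf_map_mul_inv_mul_orderOf_mul_map_dvd hcard τ ha)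
  have hp1 : (1 : ℝ) ≤ p := mod_cast hp.one_le
  have hmul := mul_le_mul hM hN (div_nonneg (by linarith) (by positivity)) (by positivity)
  have hdvd' := hmul.trans (mod_cast hdvd : _ ≤ (2 * orderOf (Ideal.Quotient.mk I α) : ℝ))
  calc ((p : ℝ) ^ 2 - 1) / (2 * e₁ * e₂) = ((p + 1) / e₁ * ((p - 1) / e₂)) / 2 := by
        field_simp; ring
    _ ≤ _ := by linarith
end

section
/- There exists a constant c > 0 such that for all real z ≥ 2, ∏_{q prime, 3 < q < z} (1 − 2/(q − 1)) ≥ c/(log z)². -/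
open Finset Real in
/-- An upper bound of Mertens type: `∑_{p ≤ n} (log p) / p ≤ log n + log 4`. -/
theorem sum_primesLE_log_div_le (n : ℕ) (hn : 0 < n) :
    ∑ p ∈ n.primesLE, log p / p ≤ log n + log 4 := by
  have hn' : (0 : ℝ) < n := by exact_mod_cast hn
  have hlog (k : ℕ) (hk : k ∈ range n) :
      ∑ p ∈ n.primesLE with p ∣ k + 1, log p ≤ log n := by
    have hsub : {p ∈ n.primesLE | p ∣ k + 1} ⊆ (k + 1).primeFactors := by
      intro p hp
      simp only [mem_filter, Nat.mem_primesLE] at hp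
      simp [hp]
    calc
      _ ≤ ∑ p ∈ (k + 1).primeFactors, log p :=
          sum_le_sum_of_subset_of_nonneg hsub fun p _ _ => log_natCast_nonneg p
      _ = log ((∏ p ∈ (k + 1).primeFactors, p : ℕ) : ℝ) := by
          rw [Nat.cast_prod, log_prod]
          intro p hp
          exact_mod_cast (Nat.prime_of_mem_primeFactors hp).ne_zero
      _ ≤ log n := by
          apply log_le_log
          · exact_mod_cast Finset.prod_pos fun p hp => (Nat.prime_of_mem_primeFactors hp).pos
          · have := Nat.le_of_dvd k.succ_pos (Nat.prod_primeFactors_dvd (k + 1))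
            have := mem_range.1 hk
            exact_mod_cast (by omega)
  have hfac : ∑ p ∈ n.primesLE, ((n / p : ℕ) : ℝ) * log p ≤ n * log n := calc
    _ = ∑ p ∈ n.primesLE, ∑ k ∈ range n with p ∣ k + 1, log p := by
        refine sum_congr rfl fun p _ => ?_
        rw [sum_const, Nat.card_multiples, nsmul_eq_mul]
    _ = ∑ k ∈ range n, ∑ p ∈ n.primesLE with p ∣ k + 1, log p := by
        simp_rw [sum_filter]
        exact sum_comm
    _ ≤ ∑ k ∈ range n, log n := sum_le_sum hlog
    _ = n * log n := by simp
  have htheta : ∑ p ∈ n.primesLE, log p ≤ log 4 * n := by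
    rw [← Chebyshev.theta_eq_sum_primesLE_log]
    exact Chebyshev.theta_le_log4_mul_x hn'.le
  have hterm : ∑ p ∈ n.primesLE, (n * (log p / p) - log p) ≤
      ∑ p ∈ n.primesLE, ((n / p : ℕ) : ℝ) * log p := by
    refine sum_le_sum fun p _ => ?_
    have h : (n : ℝ) / p ≤ (n / p : ℕ) + 1 := by
      rw [← Nat.floor_div_eq_div (K := ℝ)]
      exact (Nat.lt_floor_add_one _).le
    have := mul_le_mul_of_nonneg_right h (log_natCast_nonneg p)
    have heq : (n : ℝ) / p * log p = n * (log p / p) := by ring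
    linarith
  rw [sum_sub_distrib, ← mul_sum] at hterm
  refine le_of_mul_le_mul_left ?_ hn'
  linarith

/-- The real-valued completely multiplicative function `n ↦ n ^ (-s)`. -/
noncomputable def natRpowNegHom (s : ℝ) : ℕ →* ℝ where
  toFun n := (n : ℝ) ^ (-s)
  map_one' := by simp
  map_mul' m n := by
    rw [Nat.cast_mul, Real.mul_rpow m.cast_nonneg n.cast_nonneg]

open Finset Real in
/-- The partial Euler product bound `∑_{p ≤ n} p ^ (-s) ≤ log (1 + 1 / (s - 1))` for `s > 1`. -/
theorem sum_primesLE_rpow_neg_le (n : ℕ) {s : ℝ} (hs : 1 < s) :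
    ∑ p ∈ n.primesLE, (p : ℝ) ^ (-s) ≤ log (1 + 1 / (s - 1)) := by
  have hsum : Summable (natRpowNegHom s) := by
    change Summable fun n : ℕ => (n : ℝ) ^ (-s)
    exact summable_nat_rpow.2 (by linarith)
  have hnonneg (k : ℕ) : 0 ≤ natRpowNegHom s k := rpow_nonneg k.cast_nonneg _
  have hzeta : ∑' k, natRpowNegHom s k ≤ 1 + 1 / (s - 1) := by
    have hzero : natRpowNegHom s 0 = 0 := by
      change ((0 : ℕ) : ℝ) ^ (-s) = 0
      rw [Nat.cast_zero, zero_rpow (by linarith)]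
    have hshift : ∑' k, natRpowNegHom s k = ∑' k : ℕ, 1 / (k + 1 : ℝ) ^ s := by
      rw [hsum.tsum_eq_zero_add, hzero, zero_add]
      refine tsum_congr fun k => ?_
      change ((k + 1 : ℕ) : ℝ) ^ (-s) = _
      rw [rpow_neg (by positivity), one_div, Nat.cast_succ]
    have hterm : 0 ≤ ZetaAsymptotics.termTSum s :=
      tsum_nonneg fun k => ZetaAsymptotics.term_nonneg (k + 1) s
    have := ZetaAsymptotics.zeta_limit_aux1 hs
    have : 0 ≤ s * ZetaAsymptotics.termTSum s := mul_nonneg (by linarith) hterm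
    linarith
  have hprod : ∏ p ∈ n.primesLE, (1 - natRpowNegHom s p)⁻¹ ≤ 1 + 1 / (s - 1) := by
    change ∏ p ∈ (n + 1).primesBelow, _ ≤ _
    rw [EulerProduct.prod_primesBelow_geometric_eq_tsum_smoothNumbers hsum]
    exact (hsum.tsum_subtype_le _ _ hnonneg).trans hzeta
  have hs0 : 0 < s - 1 := sub_pos.2 hs
  rw [le_log_iff_exp_le (by positivity), exp_sum]
  refine le_trans (prod_le_prod (fun _ _ => (exp_pos _).le) fun p hp => ?_) hprod
  change rexp (natRpowNegHom s p) ≤ _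
  have hlt : natRpowNegHom s p < 1 :=
    rpow_lt_one_of_one_lt_of_neg (by exact_mod_cast (Nat.mem_primesLE.1 hp).2.one_lt)
      (by linarith)
  rw [le_inv_comm₀ (exp_pos _) (by linarith), ← exp_neg]
  linarith [add_one_le_exp (-natRpowNegHom s p)]

open Finset Real in
/-- An upper bound of Mertens type: `∑_{p ≤ z} 1 / p ≤ log log z + 5`. -/
theorem sum_primesLE_inv_le {z : ℝ} (hz : 2 ≤ z) :
    ∑ p ∈ ⌊z⌋₊.primesLE, (p : ℝ)⁻¹ ≤ log (log z) + 5 := by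
  have hfloor : 0 < ⌊z⌋₊ := Nat.floor_pos.2 (by linarith)
  set L := log z
  have hL2 : log 2 ≤ L := log_le_log two_pos hz
  have hlog2 := log_two_gt_d9
  have hL0 : 0 < L := by linarith
  have hinv : 1 / L ≤ 2 := by
    rw [div_le_iff₀ hL0]
    linarith
  have hterm (p : ℕ) (hp : p ∈ ⌊z⌋₊.primesLE) :
      (p : ℝ)⁻¹ ≤ (p : ℝ) ^ (-(1 + 1 / L)) + 1 / L * (log p / p) := by
    have hp0 : (0 : ℝ) < p := by exact_mod_cast (Nat.mem_primesLE.1 hp).2.pos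
    have h1 : (p : ℝ) ^ (-(1 + 1 / L)) = (p : ℝ)⁻¹ * exp (-(1 / L * log p)) := by
      rw [neg_add, rpow_add hp0, rpow_neg_one, rpow_def_of_pos hp0]
      congr 2
      ring
    have h2 := mul_le_mul_of_nonneg_left (add_one_le_exp (-(1 / L * log p))) (inv_pos.2 hp0).le
    rw [h1]
    have h3 : (p : ℝ)⁻¹ * (-(1 / L * log p) + 1) = (p : ℝ)⁻¹ - 1 / L * (log p / p) := by ring
    linarith
  have heuler := sum_primesLE_rpow_neg_le ⌊z⌋₊ (s := 1 + 1 / L) (by simpa using hL0)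
  have hlogsum := sum_primesLE_log_div_le ⌊z⌋₊ hfloor
  have hfl : log ⌊z⌋₊ ≤ L :=
    log_le_log (by exact_mod_cast hfloor) (Nat.floor_le (by linarith))
  have hlog4 : log 4 ≤ 2 * L := by
    rw [show (4 : ℝ) = 2 ^ 2 by norm_num, log_pow]
    push_cast
    linarith
  have hsecond : 1 / L * ∑ p ∈ ⌊z⌋₊.primesLE, log p / p ≤ 3 := by
    rw [one_div_mul_eq_div, div_le_iff₀ hL0]
    linarith
  have hfirst : log (1 + 1 / (1 + 1 / L - 1)) ≤ log L + 2 := by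
    have : 1 + 1 / (1 + 1 / L - 1) = L * (1 + 1 / L) := by
      field_simp
      ring
    rw [this, log_mul hL0.ne' (by positivity)]
    linarith [log_le_sub_one_of_pos (show 0 < 1 + 1 / L by positivity)]
  calc
    _ ≤ ∑ p ∈ ⌊z⌋₊.primesLE, ((p : ℝ) ^ (-(1 + 1 / L)) + 1 / L * (log p / p)) :=
        sum_le_sum hterm
    _ ≤ log L + 5 := by
        rw [sum_add_distrib, ← mul_sum]
        linarith

/-- For `q ≥ 5`, the factor `1 - 2 / (q - 1)` is at least `exp (-(2 / q + 15 / q ^ 2))`. -/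
theorem exp_neg_le_one_sub_two_div {q : ℝ} (hq : 5 ≤ q) :
    Real.exp (-(2 * q⁻¹ + 15 * (1 / q ^ 2))) ≤ 1 - 2 / (q - 1) := by
  have h1 : 0 < q - 1 := by linarith
  have h3 : 0 < q - 3 := by linarith
  have hq0 : 0 < q := by linarith
  have hfactor : 1 - 2 / (q - 1) = (1 + 2 / (q - 3))⁻¹ := by
    field_simp
    ring
  have hexp : 2 / (q - 3) ≤ 2 * q⁻¹ + 15 * (1 / q ^ 2) := by
    have : 2 * q⁻¹ + 15 * (1 / q ^ 2) = (2 * q + 15) / q ^ 2 := by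
      field_simp
    rw [this, div_le_div_iff₀ h3 (by positivity)]
    nlinarith
  rw [hfactor, Real.exp_neg]
  apply inv_anti₀ (by positivity)
  linarith [Real.add_one_le_exp (2 * q⁻¹ + 15 * (1 / q ^ 2))]

open scoped Classical

/-- There is a constant `c > 0` such that for all real `z ≥ 2`,
`∏_{q prime, 3 < q < z} (1 - 2/(q-1)) ≥ c/(log z)²`. -/
theorem stmt_7 :
    ∃ c : ℝ, 0 < c ∧ ∀ z : ℝ, 2 ≤ z →
      c / Real.log z ^ 2 ≤
        ∏ q ∈ (Finset.range (⌈z⌉₊ + 1)).filter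
            (fun q : ℕ => q.Prime ∧ 3 < q ∧ (q : ℝ) < z),
          (1 - 2 / ((q : ℝ) - 1)) := by
  have hsq : Summable fun n : ℕ => 1 / (n : ℝ) ^ 2 :=
    Real.summable_one_div_nat_pow.2 one_lt_two
  set S := ∑' n : ℕ, 1 / (n : ℝ) ^ 2
  refine ⟨Real.exp (-(10 + 15 * S)), Real.exp_pos _, fun z hz => ?_⟩
  set A := (Finset.range (⌈z⌉₊ + 1)).filter
    (fun q : ℕ => q.Prime ∧ 3 < q ∧ (q : ℝ) < z)
  have hlog : 0 < Real.log z := Real.log_pos (by linarith)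
  have hge (q : ℕ) (hq : q ∈ A) : (5 : ℝ) ≤ q := by
    obtain ⟨-, hp, h3, -⟩ := Finset.mem_filter.1 hq
    have h4 : q ≠ 4 := by
      rintro rfl
      norm_num at hp
    exact_mod_cast (by omega : 5 ≤ q)
  have hsub : A ⊆ ⌊z⌋₊.primesLE := by
    intro q hq
    obtain ⟨-, hp, -, hlt⟩ := Finset.mem_filter.1 hq
    exact Nat.mem_primesLE.2 ⟨Nat.le_floor hlt.le, hp⟩
  have hinv : ∑ q ∈ A, (q : ℝ)⁻¹ ≤ Real.log (Real.log z) + 5 :=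
    (Finset.sum_le_sum_of_subset_of_nonneg hsub fun _ _ _ => by positivity).trans
      (sum_primesLE_inv_le hz)
  have hsqA : ∑ q ∈ A, 1 / (q : ℝ) ^ 2 ≤ S :=
    hsq.sum_le_tsum A fun _ _ => by positivity
  calc
    Real.exp (-(10 + 15 * S)) / Real.log z ^ 2
        = Real.exp (-(2 * (Real.log (Real.log z) + 5) + 15 * S)) := by
        have : Real.log z ^ 2 = Real.exp (2 * Real.log (Real.log z)) := by
          rw [two_mul, Real.exp_add, Real.exp_log hlog, sq]
        rw [this, ← Real.exp_sub]
        congr 1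
        ring
    _ ≤ Real.exp (∑ q ∈ A, -(2 * (q : ℝ)⁻¹ + 15 * (1 / (q : ℝ) ^ 2))) := by
        apply Real.exp_le_exp.2
        rw [Finset.sum_neg_distrib, Finset.sum_add_distrib, ← Finset.mul_sum, ← Finset.mul_sum]
        linarith
    _ = ∏ q ∈ A, Real.exp (-(2 * (q : ℝ)⁻¹ + 15 * (1 / (q : ℝ) ^ 2))) := Real.exp_sum _ _
    _ ≤ _ := Finset.prod_le_prod (fun _ _ => (Real.exp_pos _).le) fun q hq =>
        exp_neg_le_one_sub_two_div (hge q hq)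
end

section
/- Let a and Δ be nonzero integers such that for every quadruple (b₀, b₁, b₂, b₃) ∈ {0,1}⁴ with b₀ + b₁ + b₂ + b₃ odd, the integer (−1)^{b₀}·5^{b₁}·a^{b₂}·Δ^{b₃} is not a perfect square. Then there are infinitely many odd primes p not dividing 5·a·Δ such that the Legendre symbols satisfy (−1/p) = (5/p) = (a/p) = (Δ/p) = −1. -/
open scoped NumberTheorySymbols

/-- The Jacobi symbol `J(d | b)` only depends on `b` modulo any multiple of `4 * |d|`. -/
theorem jacobiSym_mod_right_of_dvd {d : ℤ} {N b : ℕ} (hN : 4 * d.natAbs ∣ N) (hb : Odd b) :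
    J(d | b % N) = J(d | b) := by
  have hb' : Odd (b % N) := hb.mod_even <| by
    obtain ⟨k, rfl⟩ := hN
    exact ⟨2 * d.natAbs * k, by ring⟩
  rw [jacobiSym.mod_right d hb', jacobiSym.mod_right d hb, Nat.mod_mod_of_dvd _ hN]

theorem jacobiSym_congr_right {d : ℤ} {N b c : ℕ} (hN : 4 * d.natAbs ∣ N) (hb : Odd b)
    (hc : Odd c) (h : b ≡ c [MOD N]) : J(d | b) = J(d | c) := by
  rw [← jacobiSym_mod_right_of_dvd hN hb, ← jacobiSym_mod_right_of_dvd hN hc, h]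

theorem ZMod.odd_val_unit {N : ℕ} (hN : Even N) (u : (ZMod N)ˣ) : Odd (u : ZMod N).val :=
  Nat.not_even_iff_odd.mp fun h ↦ by
    have := Nat.dvd_gcd h.two_dvd hN.two_dvd
    rw [ZMod.val_coe_unit_coprime u] at this
    omega

/-- The Jacobi symbol `J(d | ·)` as a character of `(ℤ/N)ˣ`, for `N` a multiple of `4 * |d|`. -/
def jacobiUnitsHom (d : ℤ) (N : ℕ) [NeZero N] (hN : 4 * d.natAbs ∣ N) : (ZMod N)ˣ →* ℤ where
  toFun u := J(d | (u : ZMod N).val)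
  map_one' := by
    have h : (1 : ZMod N).val = 1 % N := by
      rw [← Nat.cast_one, ZMod.val_natCast]
    rw [Units.val_one, h, jacobiSym_mod_right_of_dvd hN odd_one, jacobiSym.one_right]
  map_mul' u v := by
    have hE : Even N := by
      obtain ⟨k, rfl⟩ := hN
      exact ⟨2 * d.natAbs * k, by ring⟩
    have hu := ZMod.odd_val_unit hE u
    have hv := ZMod.odd_val_unit hE v
    rw [Units.val_mul, ZMod.val_mul, jacobiSym_mod_right_of_dvd hN (hu.mul hv),
      jacobiSym.mul_right' _ hu.pos.ne' hv.pos.ne']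

theorem jacobiUnitsHom_apply (d : ℤ) (N : ℕ) [NeZero N] (hN : 4 * d.natAbs ∣ N) (u : (ZMod N)ˣ) :
    jacobiUnitsHom d N hN u = J(d | (u : ZMod N).val) := rfl

/-- If `q` is an odd prime not dividing `m`, then `q * m` is a non-residue modulo infinitely many
primes. -/
theorem exists_prime_gt_jacobiSym_prime_mul_eq_neg_one {q : ℕ} (hq : q.Prime) (hq2 : q ≠ 2) {m : ℤ}
    (hm : m ≠ 0) (hqm : ¬ (q : ℤ) ∣ m) (n : ℕ) :
    ∃ p > n, p.Prime ∧ J(q * m | p) = -1 := by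
  have : Fact q.Prime := ⟨hq⟩
  obtain ⟨x, hx⟩ := FiniteField.exists_nonsquare (F := ZMod q) (by rwa [ZMod.ringChar_zmod_n])
  have hx0 : x ≠ 0 := by
    rintro rfl
    exact hx IsSquare.zero
  have hcop : Nat.Coprime q (4 * m.natAbs) := by
    refine Nat.Coprime.mul_right ?_ ?_
    · exact (Nat.Coprime.pow_right 2 ((Nat.coprime_primes hq Nat.prime_two).mpr hq2) :)
    · rwa [hq.coprime_iff_not_dvd, ← Int.natCast_dvd]
  obtain ⟨c, hcq, hcm⟩ := Nat.chineseRemainder hcop x.val 1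
  have hc : c.Coprime (q * (4 * m.natAbs)) := by
    refine Nat.Coprime.mul_right ?_ ?_
    · rw [Nat.Coprime, hcq.gcd_eq]
      exact ((ZMod.isUnit_iff_coprime x.val q).mp (by simpa using hx0.isUnit))
    · rw [Nat.Coprime, hcm.gcd_eq, Nat.gcd_one_left]
  obtain ⟨p, hpn, hp, hpc⟩ := Nat.forall_exists_prime_gt_and_modEq n
    (mul_ne_zero hq.ne_zero (by simpa using hm)) hc
  have hpm : p ≡ 1 [MOD 4 * m.natAbs] := (hpc.of_mul_left _).trans hcm
  have hpq : p ≡ x.val [MOD q] := (hpc.of_mul_right _).trans hcq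
  have hp4 : p % 4 = 1 := hpm.of_mul_right _
  have hpodd : Odd p := Nat.odd_iff.mpr (by omega)
  refine ⟨p, hpn, hp, ?_⟩
  have hpx : ((p : ℤ) : ZMod q) = x := by
    rw [Int.cast_natCast, (ZMod.natCast_eq_natCast_iff _ _ _).mpr hpq, ZMod.natCast_zmod_val]
  rw [jacobiSym.mul_left, jacobiSym_congr_right dvd_rfl hpodd odd_one hpm, jacobiSym.one_right,
    mul_one, jacobiSym.quadratic_reciprocity_one_mod_four' (hq.odd_of_ne_two hq2) hp4]
  exact ZMod.nonsquare_iff_jacobiSym_eq_neg_one.mpr (hpx ▸ hx)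

/-- An integer that is not a square is a non-residue modulo infinitely many primes. -/
theorem exists_prime_gt_jacobiSym_eq_neg_one {d : ℤ} (hd : d ≠ 0) (hsq : ¬ IsSquare d) (n : ℕ) :
    ∃ p > n, p.Prime ∧ J(d | p) = -1 := by
  obtain ⟨r, s, hrs, hr⟩ := Nat.sq_mul_squarefree d.natAbs
  have hs : s ≠ 0 := by
    rintro rfl
    exact hd (Int.natAbs_eq_zero.mp (by simpa using hrs.symm))
  obtain ⟨e, hde, her⟩ : ∃ e : ℤ, d = s ^ 2 * e ∧ e.natAbs = r := by
    rcases Int.natAbs_eq d with h | h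
    · exact ⟨r, by rw [h, ← hrs]; push_cast; ring, by simp⟩
    · exact ⟨-r, by rw [h, ← hrs]; push_cast; ring, by simp⟩
  have he0 : e ≠ 0 := by
    rintro rfl
    simp [hd] at hde
  have he1 : e ≠ 1 := by
    rintro rfl
    exact hsq ⟨s, by rw [hde]; ring⟩
  suffices ∃ p > n + s, p.Prime ∧ J(e | p) = -1 by
    obtain ⟨p, hpn, hp, hpe⟩ := this
    refine ⟨p, by omega, hp, ?_⟩
    have hsp : (s : ℤ).gcd p = 1 := by
      rw [Int.gcd_natCast_natCast]
      exact (Nat.coprime_of_lt_prime hs (by omega) hp).symm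
    rw [hde, jacobiSym.mul_left, jacobiSym.sq_one' hsp, one_mul, hpe]
  by_cases hodd : ∃ q : ℕ, q.Prime ∧ q ≠ 2 ∧ q ∣ r
  · obtain ⟨q, hq, hq2, hqr⟩ := hodd
    obtain ⟨m, rfl⟩ : (q : ℤ) ∣ e := Int.natCast_dvd.mpr (her ▸ hqr)
    refine exists_prime_gt_jacobiSym_prime_mul_eq_neg_one hq hq2 (right_ne_zero_of_mul he0) ?_ _
    intro hqm
    refine hq.one_lt.ne' (Nat.isUnit_iff.mp (hr q ?_))
    rw [← her, Int.natAbs_mul, Int.natAbs_natCast]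
    exact mul_dvd_mul_left q (Int.natCast_dvd.mp hqm)
  · have hr2 : r = 1 ∨ r = 2 := by
      push Not at hodd
      refine (Nat.dvd_prime Nat.prime_two).mp ?_
      rw [← Nat.prod_primeFactors_of_squarefree hr]
      have hsub : r.primeFactors ⊆ {2} := fun q hq ↦ by
        have := Nat.mem_primeFactors.mp hq
        by_contra hne
        exact hodd q this.1 (by simpa using hne) this.2.1
      simpa using Finset.prod_dvd_prod_of_subset _ _ (fun p ↦ p) hsub
    have key : ∀ c : ℕ, c.Coprime 8 → J(e | c) = -1 → ∃ p > n + s, p.Prime ∧ J(e | p) = -1 := by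
      intro c hc hec
      obtain ⟨p, hpn, hp, hpc⟩ := Nat.forall_exists_prime_gt_and_modEq (n + s) (by norm_num) hc
      have hc2 : Odd c := Nat.not_even_iff_odd.mp fun h ↦ by
        have := Nat.dvd_gcd h.two_dvd (by norm_num : 2 ∣ 8)
        rw [hc] at this
        omega
      have hp2 : Odd p := by
        rw [Nat.odd_iff] at hc2 ⊢
        rw [← hc2]
        exact hpc.of_dvd (by norm_num)
      have h8 : 4 * e.natAbs ∣ 8 := by
        rcases hr2 with h | h <;> rw [her, h] <;> norm_num
      exact ⟨p, hpn, hp, by rw [jacobiSym_congr_right h8 hp2 hc2 hpc, hec]⟩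
    obtain rfl | rfl | rfl : e = -1 ∨ e = 2 ∨ e = -2 := by omega
    · exact key 3 (by norm_num) (by norm_num)
    · exact key 3 (by norm_num) (by norm_num)
    · exact key 5 (by norm_num) (by norm_num)

theorem sum_jacobiSym_units_nonneg {d : ℤ} {N : ℕ} [NeZero N] (hN : 4 * d.natAbs ∣ N) :
    0 ≤ ∑ u : (ZMod N)ˣ, J(d | (u : ZMod N).val) := by
  classical
  simp_rw [← jacobiUnitsHom_apply d N hN]
  rw [sum_hom_units]
  split_ifs <;> simp

theorem sum_jacobiSym_units_eq_zero {d : ℤ} {N : ℕ} [NeZero N] (hN : 4 * d.natAbs ∣ N)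
    (hsq : ¬ IsSquare d) : ∑ u : (ZMod N)ˣ, J(d | (u : ZMod N).val) = 0 := by
  simp_rw [← jacobiUnitsHom_apply d N hN]
  refine sum_hom_units_eq_zero _ fun h1 ↦ ?_
  have hd : d ≠ 0 := by
    rintro rfl
    exact hsq IsSquare.zero
  obtain ⟨p, hpN, hp, hpd⟩ := exists_prime_gt_jacobiSym_eq_neg_one hd hsq (N + 2)
  have hpodd : Odd p := hp.odd_of_ne_two (by omega)
  have hcop : p.Coprime N := Nat.coprime_of_lt_prime (NeZero.ne N) (by omega) hp
  have := DFunLike.congr_fun h1 (ZMod.unitOfCoprime p hcop)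
  rw [jacobiUnitsHom_apply, ZMod.coe_unitOfCoprime, ZMod.val_natCast,
    jacobiSym_mod_right_of_dvd hN hpodd, hpd] at this
  simp at this

theorem jacobiSym_prod_left {ι : Type*} (s : Finset ι) (d : ι → ℤ) (b : ℕ) :
    J(∏ i ∈ s, d i | b) = ∏ i ∈ s, J(d i | b) := by
  classical
  induction s using Finset.induction_on with
  | empty => simp
  | insert i s hi ih => rw [Finset.prod_insert hi, Finset.prod_insert hi, jacobiSym.mul_left, ih]

/-- If no product of an odd number of the integers `d i` is a square, then the `d i` are
simultaneously non-residues modulo infinitely many primes. -/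
theorem infinite_primes_jacobiSym_eq_neg_one {ι : Type*} [Fintype ι] (d : ι → ℤ)
    (hd : ∀ i, d i ≠ 0) (hsq : ∀ s : Finset ι, Odd s.card → ¬ IsSquare (∏ i ∈ s, d i)) :
    {p : ℕ | p.Prime ∧ Odd p ∧ ∀ i, J(d i | p) = -1}.Infinite := by
  classical
  set N : ℕ := 4 * (∏ i, d i).natAbs with hNdef
  have hN0 : N ≠ 0 := by simpa [hNdef, Finset.prod_eq_zero_iff] using hd
  have : NeZero N := ⟨hN0⟩
  have hdvd (s : Finset ι) : 4 * (∏ i ∈ s, d i).natAbs ∣ N :=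
    mul_dvd_mul_left 4 (Int.natAbs_dvd_natAbs.mpr
      (Finset.prod_dvd_prod_of_subset _ _ _ (Finset.subset_univ s)))
  have hpos : 0 < ∑ u : (ZMod N)ˣ, ∏ i, (1 - J(d i | (u : ZMod N).val)) := by
    simp_rw [sub_eq_add_neg, Finset.prod_one_add, Finset.prod_neg, ← jacobiSym_prod_left]
    rw [Finset.sum_comm]
    simp_rw [← Finset.mul_sum]
    refine Finset.sum_pos' (fun s _ ↦ ?_) ⟨∅, by simp, by simp [Nat.pos_of_neZero]⟩
    rcases Nat.even_or_odd s.card with hs | hs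
    · rw [hs.neg_one_pow, one_mul]
      exact sum_jacobiSym_units_nonneg (hdvd s)
    · rw [sum_jacobiSym_units_eq_zero (hdvd s) (hsq s hs), mul_zero]
  obtain ⟨u, -, hu⟩ := Finset.exists_ne_zero_of_sum_ne_zero hpos.ne'
  have huJ (i : ι) : J(d i | (u : ZMod N).val) = -1 := by
    have hi : (d i).natAbs ∣ N := (Int.natAbs_dvd_natAbs.mpr
      (Finset.dvd_prod_of_mem d (Finset.mem_univ i))).trans (dvd_mul_left _ 4)
    have hgcd : (d i).gcd ((u : ZMod N).val : ℤ) = 1 :=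
      ((ZMod.val_coe_unit_coprime u).coprime_dvd_right hi).symm
    refine (jacobiSym.eq_one_or_neg_one hgcd).resolve_left fun h1 ↦ hu ?_
    exact Finset.prod_eq_zero (Finset.mem_univ i) (by rw [h1, sub_self])
  refine Set.infinite_of_forall_exists_gt fun n ↦ ?_
  obtain ⟨p, hpn, hp, hpu⟩ := Nat.forall_exists_prime_gt_and_eq_mod u.isUnit (n + 2)
  have hpodd : Odd p := hp.odd_of_ne_two (by omega)
  refine ⟨p, ⟨hp, hpodd, fun i ↦ ?_⟩, by omega⟩
  have hi : 4 * (d i).natAbs ∣ N := by simpa using hdvd {i}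
  rw [← jacobiSym_mod_right_of_dvd hi hpodd, ← ZMod.val_natCast, hpu, huJ i]

/-- Let `a, Δ` be nonzero integers such that for every `(b₀,b₁,b₂,b₃) ∈ {0,1}⁴` with
`b₀+b₁+b₂+b₃` odd, the integer `(-1)^{b₀}·5^{b₁}·a^{b₂}·Δ^{b₃}` is not a perfect square.
Then there are infinitely many odd primes `p ∤ 5·a·Δ` with
`(-1/p) = (5/p) = (a/p) = (Δ/p) = -1` (Legendre symbols, given as Jacobi symbols). -/
theorem stmt_11 (a Δ : ℤ) (ha : a ≠ 0) (hΔ : Δ ≠ 0)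
    (h : ∀ b₀ b₁ b₂ b₃ : ℕ, b₀ ≤ 1 → b₁ ≤ 1 → b₂ ≤ 1 → b₃ ≤ 1 →
      Odd (b₀ + b₁ + b₂ + b₃) →
      ¬ IsSquare ((-1 : ℤ) ^ b₀ * 5 ^ b₁ * a ^ b₂ * Δ ^ b₃)) :
    {p : ℕ | p.Prime ∧ Odd p ∧ ¬ (p : ℤ) ∣ 5 * a * Δ ∧
      jacobiSym (-1) p = -1 ∧ jacobiSym 5 p = -1 ∧
      jacobiSym a p = -1 ∧ jacobiSym Δ p = -1}.Infinite := by
  have hinf := infinite_primes_jacobiSym_eq_neg_one ![-1, 5, a, Δ]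
    (by simp [Fin.forall_fin_succ, ha, hΔ]) fun s hs ↦ by
      have hle (i : Fin 4) : (if i ∈ s then 1 else 0) ≤ 1 := by split_ifs <;> simp
      have hcard : s.card = ∑ i : Fin 4, if i ∈ s then 1 else 0 := by simp
      have hprod : ∏ i ∈ s, ![-1, 5, a, Δ] i =
          ∏ i : Fin 4, ![-1, 5, a, Δ] i ^ (if i ∈ s then 1 else 0) := by
        simp [pow_ite, Finset.prod_ite_mem]
      rw [hcard, Fin.sum_univ_four] at hs
      rw [hprod, Fin.prod_univ_four]
      exact h _ _ _ _ (hle 0) (hle 1) (hle 2) (hle 3) hs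
  refine hinf.mono ?_
  rintro p ⟨hp, hodd, hJ⟩
  have h0 : J(-1 | p) = -1 := hJ 0
  have h1 : J(5 | p) = -1 := hJ 1
  have h2 : J(a | p) = -1 := hJ 2
  have h3 : J(Δ | p) = -1 := hJ 3
  refine ⟨hp, hodd, fun hdvd ↦ ?_, h0, h1, h2, h3⟩
  have hJ0 : J(5 * a * Δ | p) = 0 := by
    rw [jacobiSym.mod_left, Int.emod_eq_zero_of_dvd hdvd, jacobiSym.zero_left hp.one_lt]
  rw [jacobiSym.mul_left, jacobiSym.mul_left, h1, h2, h3] at hJ0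
  norm_num at hJ0
end

section
/- Let n be a nonzero integer that is not a perfect square. Then ∑_{p ≤ Z, p prime, p ∤ 2n} (n/p) = o(π(Z)) as Z → ∞; that is, the ratio of this sum of Legendre symbols to π(Z), the number of primes up to Z, tends to 0 as Z tends to infinity. -/
open Filter Topology MeasureTheory Set
open scoped NumberTheorySymbols

/-- The Fejér kernel on the real line. -/
noncomputable def fejer (u : ℝ) : ℝ := Real.sinc (u / 2) ^ 2

lemma fejer_nonneg (u : ℝ) : 0 ≤ fejer u := sq_nonneg _

lemma continuous_fejer : Continuous fejer := by
  unfold fejer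
  fun_prop

lemma fejer_le_inv_one_add_sq (u : ℝ) : fejer u ≤ 5 * (1 + u ^ 2)⁻¹ := by
  rw [← div_eq_mul_inv, le_div_iff₀ (by positivity), fejer]
  have h1 : Real.sinc (u / 2) ^ 2 ≤ 1 := by
    rw [sq_le_one_iff_abs_le_one]; exact Real.abs_sinc_le_one _
  have h2 : u ^ 2 * Real.sinc (u / 2) ^ 2 ≤ 4 := by
    rcases eq_or_ne u 0 with rfl | hu
    · simp
    · rw [Real.sinc_of_ne_zero (by positivity)]
      field_simp
      have := Real.sin_sq_le_one (u / 2)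
      linarith
  linarith

lemma integrable_fejer : Integrable fejer :=
  (integrable_inv_one_add_sq.const_mul 5).mono' continuous_fejer.aestronglyMeasurable <|
    .of_forall fun u ↦ by
      rw [Real.norm_of_nonneg (fejer_nonneg u)]
      exact fejer_le_inv_one_add_sq u

lemma integral_fejer_pos : 0 < ∫ u, fejer u :=
  integral_pos_of_integrable_nonneg_nonzero continuous_fejer integrable_fejer
    fejer_nonneg (x := 0) (by simp [fejer])

/-- The Fejér kernel is the Fourier transform of the triangle function. -/
lemma integral_triangle_mul_exp (u : ℝ) :
    ∫ y in (-1 : ℝ)..1, ((1 - |y| : ℝ) : ℂ) * Complex.exp (Complex.I * u * y) = fejer u := by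
  have hfint (a b : ℝ) : IntervalIntegrable
      (fun y : ℝ ↦ ((1 - |y| : ℝ) : ℂ) * Complex.exp (Complex.I * u * y)) volume a b :=
    Continuous.intervalIntegrable (by fun_prop) _ _
  have hneg : ∫ y in (-1 : ℝ)..0, ((1 - |y| : ℝ) : ℂ) * Complex.exp (Complex.I * u * y) =
      ∫ y in (0 : ℝ)..1, ((1 - |y| : ℝ) : ℂ) * Complex.exp (-(Complex.I * u * y)) := by
    have := intervalIntegral.integral_comp_neg (a := 0) (b := 1)
      (fun y : ℝ ↦ ((1 - |y| : ℝ) : ℂ) * Complex.exp (Complex.I * u * y))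
    simpa using this.symm
  rw [← intervalIntegral.integral_add_adjacent_intervals (hfint _ 0) (hfint 0 _), hneg,
    ← intervalIntegral.integral_add (Continuous.intervalIntegrable (by fun_prop) _ _) (hfint _ _)]
  have hcos : ∫ y in (0 : ℝ)..1, (((1 - |y| : ℝ) : ℂ) * Complex.exp (-(Complex.I * u * y)) +
      ((1 - |y| : ℝ) : ℂ) * Complex.exp (Complex.I * u * y)) =
      ∫ y in (0 : ℝ)..1, ((2 * ((1 - y) * Real.cos (u * y)) : ℝ) : ℂ) := by
    refine intervalIntegral.integral_congr fun y hy ↦ ?_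
    rw [uIcc_of_le zero_le_one] at hy
    have h2 : 2 * Complex.cos (u * y) = Complex.exp (Complex.I * u * y) +
        Complex.exp (-(Complex.I * u * y)) := by
      rw [Complex.two_cos]
      congr 2 <;> ring
    simp only [abs_of_nonneg hy.1]
    push_cast
    linear_combination -(1 - (y : ℂ)) * h2
  rw [hcos, intervalIntegral.integral_ofReal]
  congr 1
  rcases eq_or_ne u 0 with rfl | hu
  · simp only [fejer, zero_mul, Real.cos_zero, mul_one, zero_div, Real.sinc_zero, one_pow]
    rw [intervalIntegral.integral_const_mul, intervalIntegral.integral_sub (by simp) (by simp)]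
    simp
    norm_num
  · have hderiv (y : ℝ) : HasDerivAt
        (fun y : ℝ ↦ 2 * ((1 - y) * Real.sin (u * y) / u - Real.cos (u * y) / u ^ 2))
        (2 * ((1 - y) * Real.cos (u * y))) y := by
      have hl : HasDerivAt (fun y : ℝ ↦ u * y) u y := by
        simpa using (hasDerivAt_id y).const_mul u
      have h1 := (((hasDerivAt_id y).const_sub 1).mul hl.sin).div_const u
      have h2 := hl.cos.div_const (u ^ 2)
      convert! (h1.sub h2).const_mul 2 using 1
      simp
      field_simp
      ring
    rw [intervalIntegral.integral_eq_sub_of_hasDerivAt (fun y _ ↦ hderiv y)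
      (Continuous.intervalIntegrable (by fun_prop) _ _), fejer,
      Real.sinc_of_ne_zero (by positivity)]
    have hc : Real.cos u = 1 - 2 * Real.sin (u / 2) ^ 2 := by
      have := Real.cos_two_mul' (u / 2)
      rw [show 2 * (u / 2) = u by ring] at this
      nlinarith [Real.sin_sq_add_cos_sq (u / 2)]
    simp [hc]
    field_simp
    ring

/-- If the Laplace transform of a bounded function extends continuously to the closed right
half-plane, then the Fejér means of the function tend to zero. -/
lemma tendsto_integral_mul_fejer {h : ℝ → ℝ} (hmeas : Measurable h) {C : ℝ}
    (hC : ∀ t, |h t| ≤ C) {g : ℂ → ℂ} (hg : ContinuousOn g {z | 0 ≤ z.re})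
    (hgh : ∀ z : ℂ, 0 < z.re → ∫ t in Ioi (0 : ℝ), (h t : ℂ) * Complex.exp (-z * t) = g z)
    {l : ℝ} (hl : 0 < l) :
    Tendsto (fun x ↦ ∫ t in Ioi (0 : ℝ), h t * fejer (l * (x - t))) atTop (𝓝 0) := by
  have hC0 : 0 ≤ C := (abs_nonneg _).trans (hC 0)
  -- the identity for the damped function
  have hdamped (x ε : ℝ) (hε : 0 < ε) :
      ((∫ t in Ioi (0 : ℝ), h t * Real.exp (-ε * t) * fejer (l * (x - t)) : ℝ) : ℂ) =
      ∫ y in Ioc (-1 : ℝ) 1, ((1 - |y| : ℝ) : ℂ) * Complex.exp (Complex.I * (l * x) * y) *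
        g (ε + l * y * Complex.I) := by
    have hexp : IntegrableOn (fun t : ℝ ↦ Real.exp (-ε * t)) (Ioi 0) :=
      integrableOn_exp_mul_Ioi (by linarith) 0
    have hprod : Integrable (Function.uncurry fun t y : ℝ ↦ ((h t : ℂ) * Real.exp (-ε * t)) *
        (((1 - |y| : ℝ) : ℂ) * Complex.exp (Complex.I * ((l * (x - t) : ℝ) : ℂ) * y)))
        ((volume.restrict (Ioi 0)).prod (volume.restrict (Ioc (-1) 1))) := by
      have hdom : Integrable (fun q : ℝ × ℝ ↦ (C * Real.exp (-ε * q.1)) * (1 + |q.2|))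
          ((volume.restrict (Ioi 0)).prod (volume.restrict (Ioc (-1) 1))) := by
        refine Integrable.mul_prod (f := fun t ↦ C * Real.exp (-ε * t)) (g := fun y ↦ 1 + |y|)
          (hexp.const_mul C) ?_
        exact (Continuous.integrableOn_Icc (by fun_prop)).mono_set Ioc_subset_Icc_self
      refine hdom.mono' (Measurable.aestronglyMeasurable (by fun_prop)) (.of_forall ?_)
      rintro ⟨t, y⟩
      have h1 : ‖Complex.exp (Complex.I * ((l * (x - t) : ℝ) : ℂ) * y)‖ = 1 := by
        rw [Complex.norm_exp]
        simp
      simp only [Function.uncurry_apply_pair, norm_mul, h1, Complex.norm_real, Real.norm_eq_abs,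
        Real.abs_exp, mul_one]
      have h2 : |(1 - |y|)| ≤ 1 + |y| := by
        rw [abs_le]; constructor <;> linarith [abs_nonneg y]
      gcongr
      exact hC t
    calc
      _ = ∫ t in Ioi (0 : ℝ), ∫ y in Ioc (-1 : ℝ) 1, ((h t : ℂ) * Real.exp (-ε * t)) *
            (((1 - |y| : ℝ) : ℂ) * Complex.exp (Complex.I * ((l * (x - t) : ℝ) : ℂ) * y)) := by
        rw [← integral_complex_ofReal]
        congr 1 with t
        rw [integral_const_mul, ← intervalIntegral.integral_of_le (by norm_num),
          integral_triangle_mul_exp]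
        push_cast
        ring
      _ = ∫ y in Ioc (-1 : ℝ) 1, ∫ t in Ioi (0 : ℝ), ((h t : ℂ) * Real.exp (-ε * t)) *
            (((1 - |y| : ℝ) : ℂ) * Complex.exp (Complex.I * ((l * (x - t) : ℝ) : ℂ) * y)) :=
        integral_integral_swap hprod
      _ = _ := by
        congr 1 with y
        rw [← hgh (ε + l * y * Complex.I) (by simpa using hε), ← integral_const_mul]
        congr 1 with t
        rw [Complex.ofReal_exp]
        calc
          _ = (h t : ℂ) * ((1 - |y| : ℝ) : ℂ) * (Complex.exp ((-ε * t : ℝ) : ℂ) *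
              Complex.exp (Complex.I * ((l * (x - t) : ℝ) : ℂ) * y)) := by ring
          _ = (h t : ℂ) * ((1 - |y| : ℝ) : ℂ) * (Complex.exp (Complex.I * (l * x) * y) *
              Complex.exp (-(ε + l * y * Complex.I) * t)) := by
            rw [← Complex.exp_add, ← Complex.exp_add]
            congr 2
            push_cast
            ring
          _ = _ := by ring
  have hgline (y : ℝ) : ContinuousOn (fun ε : ℝ ↦ g (ε + l * y * Complex.I)) (Ici 0) :=
    hg.comp (by fun_prop) fun ε hε ↦ by simpa using hε
  -- the limiting identity
  have hlimit (x : ℝ) : ((∫ t in Ioi (0 : ℝ), h t * fejer (l * (x - t)) : ℝ) : ℂ) =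
      ∫ y in Ioc (-1 : ℝ) 1, ((1 - |y| : ℝ) : ℂ) * Complex.exp (Complex.I * (l * x) * y) *
        g (l * y * Complex.I) := by
    have hfl : Integrable (fun t : ℝ ↦ fejer (l * (x - t))) := by
      have := (integrable_fejer.comp_mul_left' hl.ne').comp_sub_left x
      simpa using this
    have hleft : Tendsto
        (fun ε : ℝ ↦ ∫ t in Ioi (0 : ℝ), h t * Real.exp (-ε * t) * fejer (l * (x - t)))
        (𝓝[>] 0) (𝓝 (∫ t in Ioi (0 : ℝ), h t * fejer (l * (x - t)))) := by
      refine tendsto_integral_filter_of_dominated_convergence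
        (fun t ↦ C * fejer (l * (x - t))) ?_ ?_ (hfl.const_mul C).integrableOn ?_
      · have := continuous_fejer.measurable
        exact .of_forall fun ε ↦ Measurable.aestronglyMeasurable (by fun_prop)
      · filter_upwards [self_mem_nhdsWithin] with ε (hε : 0 < ε)
        filter_upwards [ae_restrict_mem measurableSet_Ioi] with t (ht : 0 < t)
        rw [norm_mul, norm_mul, Real.norm_of_nonneg (fejer_nonneg _), Real.norm_eq_abs,
          Real.norm_of_nonneg (Real.exp_nonneg _)]
        have : Real.exp (-ε * t) ≤ 1 := Real.exp_le_one_iff.mpr (by nlinarith)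
        have := fejer_nonneg (l * (x - t))
        gcongr
        calc |h t| * Real.exp (-ε * t) ≤ C * 1 := by gcongr; exact hC t
          _ = C := mul_one C
      · refine .of_forall fun t ↦ ?_
        have : Continuous fun ε : ℝ ↦ h t * Real.exp (-ε * t) * fejer (l * (x - t)) := by fun_prop
        simpa using (this.tendsto 0).mono_left nhdsWithin_le_nhds
    have hright : Tendsto (fun ε : ℝ ↦ ∫ y in Ioc (-1 : ℝ) 1, ((1 - |y| : ℝ) : ℂ) *
        Complex.exp (Complex.I * (l * x) * y) * g (ε + l * y * Complex.I)) (𝓝[>] 0)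
        (𝓝 (∫ y in Ioc (-1 : ℝ) 1, ((1 - |y| : ℝ) : ℂ) *
          Complex.exp (Complex.I * (l * x) * y) * g (l * y * Complex.I))) := by
      have hcomp : IsCompact ((fun q : ℝ × ℝ ↦ (q.1 + l * q.2 * Complex.I : ℂ)) ''
          (Icc 0 1 ×ˢ Icc (-1) 1)) :=
        (isCompact_Icc.prod isCompact_Icc).image (by fun_prop)
      obtain ⟨M, hM⟩ := hcomp.exists_bound_of_continuousOn (hg.mono (by
        rintro _ ⟨⟨ε, y⟩, ⟨hε, -⟩, rfl⟩
        simpa using hε.1))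
      refine tendsto_integral_filter_of_dominated_convergence (fun _ ↦ M) ?_ ?_
        (integrable_const M) ?_
      · filter_upwards [self_mem_nhdsWithin] with ε (hε : 0 < ε)
        refine ContinuousOn.aestronglyMeasurable ?_ measurableSet_Ioc
        refine ContinuousOn.mul (by fun_prop) (hg.comp (by fun_prop) fun y _ ↦ ?_)
        simpa using hε.le
      · filter_upwards [Ioc_mem_nhdsGT (zero_lt_one' ℝ)] with ε hε
        filter_upwards [ae_restrict_mem measurableSet_Ioc] with y hy
        have h1 : ‖Complex.exp (Complex.I * (l * x) * y)‖ = 1 := by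
          rw [Complex.norm_exp]
          simp
        have h2 : |(1 - |y|)| ≤ 1 := by
          have : |y| ≤ 1 := abs_le.mpr ⟨hy.1.le, hy.2⟩
          rw [abs_le]; constructor <;> linarith [abs_nonneg y]
        have h3 := hM (ε + l * y * Complex.I)
          ⟨(ε, y), ⟨⟨hε.1.le, hε.2⟩, ⟨hy.1.le, hy.2⟩⟩, rfl⟩
        rw [norm_mul, norm_mul, h1, Complex.norm_real, Real.norm_eq_abs, mul_one]
        calc _ ≤ 1 * M := by gcongr
          _ = M := one_mul M
      · refine .of_forall fun y ↦ Tendsto.const_mul _ ?_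
        have := ((hgline y) 0 self_mem_Ici).tendsto
        simpa using this.mono_left (nhdsWithin_mono _ Ioi_subset_Ici_self)
    refine tendsto_nhds_unique ((Complex.continuous_ofReal.tendsto _).comp hleft) ?_
    refine hright.congr' ?_
    filter_upwards [self_mem_nhdsWithin] with ε hε
    exact (hdamped x ε hε).symm
  -- the Riemann–Lebesgue lemma
  have hRL := Real.tendsto_integral_exp_smul_cocompact
    ((Ioc (-1 : ℝ) 1).indicator fun y : ℝ ↦ ((1 - |y| : ℝ) : ℂ) * g (l * y * Complex.I))
  have hw : Tendsto (fun x : ℝ ↦ -(l / (2 * Real.pi)) * x) atTop (cocompact ℝ) := by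
    refine (tendsto_id.const_mul_atTop_of_neg ?_).mono_right atBot_le_cocompact
    have := Real.pi_pos
    rw [neg_lt_zero]
    positivity
  have hmain : Tendsto (fun x ↦ ((∫ t in Ioi (0 : ℝ), h t * fejer (l * (x - t)) : ℝ) : ℂ))
      atTop (𝓝 ((0 : ℝ) : ℂ)) := by
    refine (hRL.comp hw).congr fun x ↦ ?_
    rw [hlimit, Function.comp_apply, ← integral_indicator measurableSet_Ioc]
    congr 1 with y
    by_cases hy : y ∈ Ioc (-1 : ℝ) 1
    · simp only [indicator_of_mem hy, Circle.smul_def, Real.fourierChar_apply, smul_eq_mul]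
      have : ((2 * Real.pi * -(y * (-(l / (2 * Real.pi)) * x)) : ℝ) : ℂ) * Complex.I =
          Complex.I * (l * x) * y := by
        rw [show 2 * Real.pi * -(y * (-(l / (2 * Real.pi)) * x)) = l * x * y by field_simp]
        push_cast
        ring
      rw [this]
      ring
    · simp only [indicator_of_notMem hy, smul_zero]
  exact Complex.continuous_re.tendsto _ |>.comp hmain |>.congr fun x ↦ by simp

/-- Under the hypotheses of the Tauberian theorem, the Fejér means converge. -/
lemma tendsto_integral_comp_sub_div_mul_fejer {H : ℝ → ℝ} (hmeas : Measurable H) {C : ℝ}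
    (hC : ∀ t, |H t| ≤ C) (hneg : ∀ t < 0, H t = 0) {κ : ℝ} {g : ℂ → ℂ}
    (hg : ContinuousOn g {z | 0 ≤ z.re})
    (hgH : ∀ z : ℂ, 0 < z.re →
      ∫ t in Ioi (0 : ℝ), ((H t - κ : ℝ) : ℂ) * Complex.exp (-z * t) = g z)
    {l : ℝ} (hl : 0 < l) :
    Tendsto (fun x ↦ ∫ v, H (x - v / l) * fejer v) atTop (𝓝 (κ * ∫ v, fejer v)) := by
  have hsmooth := tendsto_integral_mul_fejer (h := fun t ↦ H t - κ) (hmeas.sub_const κ)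
    (C := C + |κ|) (fun t ↦ (abs_sub _ _).trans (by gcongr; exact hC t)) hg hgH hl
  have hfm := continuous_fejer.measurable
  have hmeas1 : Measurable ((Ici (0 : ℝ)).indicator fun _ ↦ κ) :=
    measurable_const.indicator measurableSet_Ici
  have hmeas2 : Measurable ((Ici (0 : ℝ)).indicator fun t ↦ H t - κ) :=
    (hmeas.sub_const κ).indicator measurableSet_Ici
  have hsub (x : ℝ) : l * ∫ t in Ioi (0 : ℝ), (H t - κ) * fejer (l * (x - t)) =
      ∫ v, (Ici (0 : ℝ)).indicator (fun t ↦ H t - κ) (x - v / l) * fejer v := by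
    have h1 := Measure.integral_comp_mul_left
      (fun v ↦ (Ici (0 : ℝ)).indicator (fun t ↦ H t - κ) (x - v / l) * fejer v) l
    have h2 := integral_sub_left_eq_self (fun t ↦
      (Ici (0 : ℝ)).indicator (fun t ↦ H t - κ) (x - l * t / l) * fejer (l * t)) volume x
    rw [← integral_Ici_eq_integral_Ioi, ← integral_indicator measurableSet_Ici]
    rw [h1, abs_of_pos (inv_pos.mpr hl), smul_eq_mul] at h2
    rw [eq_inv_mul_iff_mul_eq₀ hl.ne'] at h2
    rw [← h2]
    congr 2 with t
    rw [mul_div_cancel_left₀ _ hl.ne', sub_sub_cancel]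
    by_cases ht : t ∈ Ici (0 : ℝ) <;> simp [ht]
  have hconst : Tendsto (fun x ↦ ∫ v, (Ici (0 : ℝ)).indicator (fun _ ↦ κ) (x - v / l) * fejer v)
      atTop (𝓝 (∫ v, κ * fejer v)) := by
    refine tendsto_integral_filter_of_dominated_convergence (fun v ↦ |κ| * fejer v) ?_ ?_
      (integrable_fejer.const_mul _) ?_
    · exact .of_forall fun x ↦ Measurable.aestronglyMeasurable (by fun_prop)
    · refine .of_forall fun x ↦ .of_forall fun v ↦ ?_
      rw [norm_mul, Real.norm_of_nonneg (fejer_nonneg v)]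
      gcongr
      · exact fejer_nonneg v
      · exact (norm_indicator_le_norm_self _ _).trans_eq (Real.norm_eq_abs κ)
    · refine .of_forall fun v ↦ tendsto_const_nhds.congr' ?_
      filter_upwards [eventually_ge_atTop (v / l)] with x hx
      rw [indicator_of_mem (by simpa using hx)]
  have hsum := (hsmooth.const_mul l).add hconst
  rw [mul_zero, zero_add, integral_const_mul] at hsum
  refine hsum.congr fun x ↦ ?_
  rw [hsub, ← integral_add]
  · congr 1 with v
    by_cases hv : x - v / l ∈ Ici (0 : ℝ)
    · simp only [indicator_of_mem hv]
      ring
    · simp only [indicator_of_notMem hv, hneg _ (not_le.mp hv)]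
      ring
  · refine (integrable_fejer.const_mul (C + |κ|)).mono'
      (Measurable.aestronglyMeasurable (by fun_prop)) (.of_forall fun v ↦ ?_)
    rw [norm_mul, Real.norm_of_nonneg (fejer_nonneg v)]
    gcongr
    · exact fejer_nonneg v
    · refine (norm_indicator_le_norm_self _ _).trans ?_
      exact (abs_sub _ _).trans (by gcongr; exact hC _)
  · refine (integrable_fejer.const_mul |κ|).mono'
      (Measurable.aestronglyMeasurable (by fun_prop)) (.of_forall fun v ↦ ?_)
    rw [norm_mul, Real.norm_of_nonneg (fejer_nonneg v)]
    gcongr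
    · exact fejer_nonneg v
    · exact (norm_indicator_le_norm_self _ _).trans_eq (Real.norm_eq_abs κ)

/-- A Tauberian theorem of Wiener–Ikehara type for Laplace transforms of bounded functions. -/
theorem tendsto_of_laplace_continuousOn {H : ℝ → ℝ} (hmeas : Measurable H) {C : ℝ}
    (h0 : ∀ t, 0 ≤ H t) (hC : ∀ t, H t ≤ C) (hneg : ∀ t < 0, H t = 0)
    (hmono : Monotone fun t ↦ Real.exp t * H t) {κ : ℝ} {g : ℂ → ℂ}
    (hg : ContinuousOn g {z | 0 ≤ z.re})
    (hgH : ∀ z : ℂ, 0 < z.re →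
      ∫ t in Ioi (0 : ℝ), ((H t - κ : ℝ) : ℂ) * Complex.exp (-z * t) = g z) :
    Tendsto H atTop (𝓝 κ) := by
  set M := ∫ v, fejer v with hM
  have hMpos : 0 < M := integral_fejer_pos
  set m : ℝ → ℝ := fun A ↦ ∫ v in Ioc (-A) A, fejer v with hm
  have hmlim : Tendsto m atTop (𝓝 M) := by
    have := intervalIntegral_tendsto_integral integrable_fejer tendsto_neg_atTop_atBot tendsto_id
    refine this.congr' ?_
    filter_upwards [eventually_ge_atTop 0] with A hA
    rw [intervalIntegral.integral_of_le (by simp; linarith)]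
    rfl
  have hexp : Tendsto (fun A : ℝ ↦ Real.exp (2 / A)) atTop (𝓝 1) := by
    rw [← Real.exp_zero]
    exact (Real.continuous_exp.tendsto 0).comp (tendsto_const_nhds.div_atTop tendsto_id)
  have hfejer := fun A : ℝ ↦ tendsto_integral_comp_sub_div_mul_fejer hmeas
    (fun t ↦ (abs_of_nonneg (h0 t)).trans_le (hC t)) hneg hg hgH (l := A ^ 2)
  have hfint (x A : ℝ) : Integrable fun v ↦ H (x - v / A ^ 2) * fejer v := by
    have hfm := continuous_fejer.measurable
    refine (integrable_fejer.const_mul C).mono'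
      (Measurable.aestronglyMeasurable (by fun_prop)) (.of_forall fun v ↦ ?_)
    rw [norm_mul, Real.norm_of_nonneg (fejer_nonneg v), Real.norm_of_nonneg (h0 _)]
    gcongr
    · exact fejer_nonneg v
    · exact hC _
  have hcomp {s t δ : ℝ} (hst : s ≤ t) (hts : t ≤ s + δ) : H s ≤ Real.exp δ * H t := by
    have h1 : Real.exp s * H s ≤ Real.exp t * H t := hmono hst
    have h2 : Real.exp t * H t ≤ Real.exp (s + δ) * H t := by
      gcongr
      exact h0 t
    rw [Real.exp_add, mul_assoc] at h2
    exact le_of_mul_le_mul_left (h1.trans h2) (Real.exp_pos s)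
  have hrange {A v : ℝ} (hA : 0 < A) (hv : v ∈ Ioc (-A) A) :
      -(1 / A) ≤ v / A ^ 2 ∧ v / A ^ 2 ≤ 1 / A := by
    have e : 1 / A = A / A ^ 2 := by field_simp
    rw [e, ← neg_div]
    constructor <;> gcongr
    exacts [hv.1.le, hv.2]
  have htwo (A : ℝ) : 2 / A = 2 * (1 / A) := by ring
  rw [tendsto_order]
  constructor
  · intro a ha
    have hlim : Tendsto (fun A ↦ a * (Real.exp (2 / A) * M) + C * (M - m A)) atTop
        (𝓝 (a * (1 * M) + C * (M - M))) :=
      ((hexp.mul_const M).const_mul a).add ((hmlim.const_sub M).const_mul C)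
    have hlt : a * (1 * M) + C * (M - M) < κ * M := by
      simpa using mul_lt_mul_of_pos_right ha hMpos
    obtain ⟨A, hA, hApos⟩ := ((hlim.eventually_lt_const hlt).and (eventually_gt_atTop 0)).exists
    have hev := ((hfejer A (by positivity)).comp
      (tendsto_atTop_add_const_right atTop (-(1 / A)) tendsto_id)).eventually_const_lt hA
    filter_upwards [hev] with x hx
    have hsplit := integral_add_compl (μ := volume) (measurableSet_Ioc (a := -A) (b := A))
      (hfint (x + -(1 / A)) A)
    have hsplit' := integral_add_compl (μ := volume) (measurableSet_Ioc (a := -A) (b := A))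
      integrable_fejer
    have h1 : ∫ v in Ioc (-A) A, H (x + -(1 / A) - v / A ^ 2) * fejer v ≤
        Real.exp (2 / A) * H x * m A := by
      rw [hm, ← integral_const_mul]
      refine setIntegral_mono_on (hfint _ _).integrableOn
        (integrable_fejer.const_mul _).integrableOn measurableSet_Ioc fun v hv ↦ ?_
      have := hrange hApos hv
      gcongr
      · exact fejer_nonneg v
      · exact hcomp (by linarith) (by rw [htwo]; linarith)
    have h2 : ∫ v in (Ioc (-A) A)ᶜ, H (x + -(1 / A) - v / A ^ 2) * fejer v ≤
        C * ∫ v in (Ioc (-A) A)ᶜ, fejer v := by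
      rw [← integral_const_mul]
      refine setIntegral_mono_on (hfint _ _).integrableOn
        (integrable_fejer.const_mul _).integrableOn measurableSet_Ioc.compl fun v hv ↦ ?_
      gcongr
      · exact fejer_nonneg v
      · exact hC _
    have h3 : m A ≤ M := setIntegral_le_integral integrable_fejer (.of_forall fejer_nonneg)
    have h4 : Real.exp (2 / A) * H x * m A ≤ Real.exp (2 / A) * H x * M := by
      have := h0 x
      gcongr
    have h5 : ∫ v in (Ioc (-A) A)ᶜ, fejer v = M - m A := by rw [hm, hM]; linarith
    rw [h5] at h2
    simp only [Function.comp_apply, id_eq] at hx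
    rw [← hsplit] at hx
    have h6 : a * (Real.exp (2 / A) * M) < H x * (Real.exp (2 / A) * M) := by linarith
    exact lt_of_mul_lt_mul_right h6 (by positivity)
  · intro b hb
    have hlim : Tendsto (fun A ↦ b * (m A / Real.exp (2 / A))) atTop (𝓝 (b * (M / 1))) :=
      (hmlim.div hexp one_ne_zero).const_mul b
    have hlt : κ * M < b * (M / 1) := by simpa using mul_lt_mul_of_pos_right hb hMpos
    obtain ⟨A, ⟨hA, hApos⟩, hmA⟩ := (((hlim.eventually_const_lt hlt).and
      (eventually_gt_atTop 0)).and (hmlim.eventually_const_lt hMpos)).exists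
    have hev := ((hfejer A (by positivity)).comp
      (tendsto_atTop_add_const_right atTop (1 / A) tendsto_id)).eventually_lt_const hA
    filter_upwards [hev] with x hx
    have h1 : H x / Real.exp (2 / A) * m A ≤
        ∫ v in Ioc (-A) A, H (x + 1 / A - v / A ^ 2) * fejer v := by
      rw [hm, ← integral_const_mul]
      refine setIntegral_mono_on (integrable_fejer.const_mul _).integrableOn
        (hfint _ _).integrableOn measurableSet_Ioc fun v hv ↦ ?_
      have := hrange hApos hv
      gcongr
      · exact fejer_nonneg v
      · rw [div_le_iff₀' (Real.exp_pos _)]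
        exact hcomp (by linarith) (by rw [htwo]; linarith)
    have h2 := setIntegral_le_integral (s := Ioc (-A) A) (hfint (x + 1 / A) A)
      (.of_forall fun v ↦ mul_nonneg (h0 _) (fejer_nonneg v))
    simp only [Function.comp_apply, id_eq] at hx
    have h3 : H x * (m A / Real.exp (2 / A)) < b * (m A / Real.exp (2 / A)) := by
      refine lt_of_le_of_lt ?_ hx
      refine le_trans (le_of_eq ?_) (h1.trans h2)
      ring
    exact lt_of_mul_lt_mul_right h3 (by positivity)

/-- The Laplace transform of the normalised summatory function of a nonnegative sequence whose
partial sums grow at most linearly. -/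
lemma integral_sum_exp_mul_exp_eq {f : ℕ → ℝ} (hf : ∀ n, 0 ≤ f n) {C : ℝ}
    (hC : ∀ n : ℕ, ∑ k ∈ Finset.Icc 1 n, f k ≤ C * n) {z : ℂ} (hz : 0 < z.re) :
    ∫ t in Ioi (0 : ℝ), (((∑ k ∈ Finset.Icc 1 ⌊Real.exp t⌋₊, f k) * Real.exp (-t) : ℝ) : ℂ) *
      Complex.exp (-z * t) = LSeries (fun n ↦ (f n : ℂ)) (1 + z) / (1 + z) := by
  have hz1 : (1 + z) ≠ 0 := fun h ↦ by
    have := congrArg Complex.re h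
    simp at this
    linarith
  have hO : (fun n : ℕ ↦ ∑ k ∈ Finset.Icc 1 n, f k) =O[atTop] fun n : ℕ ↦ (n : ℝ) ^ (1 : ℝ) := by
    refine Asymptotics.IsBigO.of_bound C (.of_forall fun n ↦ ?_)
    rw [Real.norm_of_nonneg (Finset.sum_nonneg fun _ _ ↦ hf _), Real.rpow_one, Real.norm_natCast]
    exact hC n
  have hL := LSeries_eq_mul_integral_of_nonneg f zero_le_one (s := 1 + z) (by simpa using hz) hO hf
  rw [hL, mul_div_cancel_left₀ _ hz1]
  have himage : Real.exp '' Ioi 0 = Ioi 1 := by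
    rw [← Real.exp_zero]
    ext y
    constructor
    · rintro ⟨t, ht, rfl⟩
      exact Real.exp_lt_exp.mpr ht
    · intro hy
      have hy0 : 0 < y := (Real.exp_pos 0).trans hy
      exact ⟨Real.log y, (Real.lt_log_iff_exp_lt hy0).mpr hy, Real.exp_log hy0⟩
  rw [← himage, integral_image_eq_integral_abs_deriv_smul measurableSet_Ioi
    (fun t _ ↦ (Real.hasDerivAt_exp t).hasDerivWithinAt) Real.exp_injective.injOn]
  congr 1 with t
  have hpow : ((Real.exp t : ℝ) : ℂ) ^ (-(1 + z + 1)) = Complex.exp (t * (-(1 + z + 1))) := by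
    rw [Complex.cpow_def_of_ne_zero (by exact_mod_cast (Real.exp_pos t).ne'),
      ← Complex.ofReal_log (Real.exp_pos t).le, Real.log_exp]
  rw [hpow, abs_of_pos (Real.exp_pos t), Complex.real_smul]
  push_cast
  calc
    _ = (∑ k ∈ Finset.Icc 1 ⌊Real.exp t⌋₊, (f k : ℂ)) *
        (Complex.exp (-t) * Complex.exp (-z * t)) := by ring
    _ = (∑ k ∈ Finset.Icc 1 ⌊Real.exp t⌋₊, (f k : ℂ)) *
        (Complex.exp t * Complex.exp (t * (-(1 + z + 1)))) := by
      rw [← Complex.exp_add, ← Complex.exp_add]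
      congr 2
      ring
    _ = _ := by ring

/-- The **Wiener–Ikehara theorem** for nonnegative sequences satisfying a Chebyshev bound. -/
theorem tendsto_sum_div_of_LSeries_sub_continuousOn {f : ℕ → ℝ} (hf : ∀ n, 0 ≤ f n) {C : ℝ}
    (hC : ∀ n : ℕ, ∑ k ∈ Finset.Icc 1 n, f k ≤ C * n) {κ : ℝ} {G : ℂ → ℂ}
    (hG : ContinuousOn G {s | 1 ≤ s.re})
    (hGf : ∀ s : ℂ, 1 < s.re → G s = LSeries (fun n ↦ (f n : ℂ)) s - κ / (s - 1)) :
    Tendsto (fun n : ℕ ↦ (∑ k ∈ Finset.Icc 1 n, f k) / n) atTop (𝓝 κ) := by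
  have hC0 : 0 ≤ C := by
    simpa using (Finset.sum_nonneg fun k _ ↦ hf k).trans (hC 1)
  set H : ℝ → ℝ := fun t ↦ (∑ k ∈ Finset.Icc 1 ⌊Real.exp t⌋₊, f k) * Real.exp (-t) with hH
  have hS0 (n : ℕ) : 0 ≤ ∑ k ∈ Finset.Icc 1 n, f k := Finset.sum_nonneg fun _ _ ↦ hf _
  have hmonoS : Monotone fun t : ℝ ↦ ∑ k ∈ Finset.Icc 1 ⌊Real.exp t⌋₊, f k := fun s t hst ↦
    Finset.sum_le_sum_of_subset_of_nonneg
      (Finset.Icc_subset_Icc_right (Nat.floor_mono (Real.exp_le_exp.mpr hst)))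
      fun _ _ _ ↦ hf _
  have h0 (t : ℝ) : 0 ≤ H t := mul_nonneg (hS0 _) (Real.exp_nonneg _)
  have hHC (t : ℝ) : H t ≤ C := by
    change _ * Real.exp (-t) ≤ C
    rw [Real.exp_neg, ← div_eq_mul_inv, div_le_iff₀ (Real.exp_pos t)]
    refine (hC _).trans ?_
    gcongr
    exact Nat.floor_le (Real.exp_nonneg t)
  have hmeas : Measurable H := hmonoS.measurable.mul (by fun_prop)
  have hneg (t : ℝ) (ht : t < 0) : H t = 0 := by
    have : ⌊Real.exp t⌋₊ = 0 := Nat.floor_eq_zero.mpr (by simpa using ht)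
    simp [hH, this]
  have hmono : Monotone fun t ↦ Real.exp t * H t := by
    convert! hmonoS using 2 with t
    rw [hH, mul_left_comm, ← Real.exp_add, add_neg_cancel, Real.exp_zero, mul_one]
  have hne {z : ℂ} (hz : 0 ≤ z.re) : 1 + z ≠ 0 := fun h ↦ by
    have := congrArg Complex.re h
    simp at this
    linarith
  have hg : ContinuousOn (fun z ↦ (G (1 + z) - κ) / (1 + z)) {z | 0 ≤ z.re} := by
    refine ContinuousOn.div (ContinuousOn.sub (hG.comp (by fun_prop) fun z hz ↦ ?_) (by fun_prop))
      (by fun_prop) fun z hz ↦ hne hz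
    simpa using hz
  have hlim : Tendsto H atTop (𝓝 κ) := by
    refine tendsto_of_laplace_continuousOn hmeas h0 hHC hneg hmono hg fun z hz ↦ ?_
    have hexp : IntegrableOn (fun t : ℝ ↦ Complex.exp (-z * t)) (Ioi 0) :=
      integrableOn_exp_mul_complex_Ioi (by simpa using hz) 0
    have hz0 : z ≠ 0 := fun h ↦ by simp [h] at hz
    have hfint : IntegrableOn (fun t : ℝ ↦ (H t : ℂ) * Complex.exp (-z * t)) (Ioi 0) := by
      refine hexp.bdd_mul (c := C) (Measurable.aestronglyMeasurable (by fun_prop))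
        (.of_forall fun t ↦ ?_)
      rw [Complex.norm_real, Real.norm_of_nonneg (h0 t)]
      exact hHC t
    have hcalc : ∫ t in Ioi (0 : ℝ), Complex.exp (-z * t) = 1 / z := by
      rw [integral_exp_mul_complex_Ioi (by simpa using hz)]
      simp
    simp only [Complex.ofReal_sub, sub_mul]
    rw [integral_sub hfint (hexp.const_mul _), integral_const_mul, hcalc,
      integral_sum_exp_mul_exp_eq hf hC hz, hGf _ (by simpa using hz)]
    have := hne hz.le
    rw [add_sub_cancel_left]
    field_simp
    ring
  refine (hlim.comp (Real.tendsto_log_atTop.comp tendsto_natCast_atTop_atTop)).congr' ?_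
  filter_upwards [eventually_gt_atTop 0] with n hn
  have hn' : (0 : ℝ) < n := by exact_mod_cast hn
  simp [hH, Real.exp_neg, Real.exp_log hn', div_eq_mul_inv]

/-- The prime number theorem in arithmetic progressions, for the von Mangoldt function. -/
theorem tendsto_sum_residueClass_div {q : ℕ} [NeZero q] {a : ZMod q} (ha : IsUnit a) :
    Tendsto (fun n : ℕ ↦
      (∑ k ∈ Finset.Icc 1 n, ArithmeticFunction.vonMangoldt.residueClass a k) / n) atTop
      (𝓝 (q.totient : ℝ)⁻¹) := by
  refine tendsto_sum_div_of_LSeries_sub_continuousOn (C := Real.log 4 + 4)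
    (ArithmeticFunction.vonMangoldt.residueClass_nonneg a) (fun n ↦ ?_)
    (ArithmeticFunction.vonMangoldt.continuousOn_LFunctionResidueClassAux a) fun s hs ↦ ?_
  · refine le_trans ?_ (Chebyshev.psi_le_const_mul_self (Nat.cast_nonneg n))
    rw [Chebyshev.psi, Nat.floor_natCast, ← Finset.Icc_add_one_left_eq_Ioc]
    exact Finset.sum_le_sum fun k _ ↦ ArithmeticFunction.vonMangoldt.residueClass_le a k
  · simpa using ArithmeticFunction.vonMangoldt.eqOn_LFunctionResidueClassAux ha hs

lemma jacobiSym_eq_one_of_modEq_one {a : ℤ} (ha : a ≠ 0) {b : ℕ}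
    (hb : b ≡ 1 [MOD 4 * a.natAbs]) : J(a | b) = 1 := by
  have hodd : Odd b := by
    have : b ≡ 1 [MOD 2] := hb.of_dvd ⟨2 * a.natAbs, by ring⟩
    exact Nat.odd_iff.mpr this
  have ha' : 0 < a.natAbs := Int.natAbs_pos.mpr ha
  rw [jacobiSym.mod_right a hodd, hb, Nat.mod_eq_of_lt (by lia), jacobiSym.one_right]

/-- An integer in which some odd prime has odd valuation is a quadratic nonresidue for some
Jacobi symbol. -/
lemma exists_jacobiSym_eq_neg_one_of_odd_pow {p : ℕ} (hp : p.Prime) (hp2 : p ≠ 2) {k : ℕ}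
    (hk : Odd k) {m : ℤ} (hpm : ¬ (p : ℤ) ∣ m) :
    ∃ b : ℕ, Odd b ∧ J((p : ℤ) ^ k * m | b) = -1 := by
  have := Fact.mk hp
  have hm : m ≠ 0 := fun h ↦ hpm (h ▸ dvd_zero _)
  obtain ⟨r, hr⟩ := FiniteField.exists_nonsquare (F := ZMod p) (by rwa [ZMod.ringChar_zmod_n])
  have hcop : Nat.Coprime p (4 * m.natAbs) := by
    rw [hp.coprime_iff_not_dvd, hp.dvd_mul]
    rintro (h | h)
    · exact hp2 ((Nat.prime_dvd_prime_iff_eq hp Nat.prime_two).mp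
        (hp.dvd_of_dvd_pow (n := 2) (by simpa using h)))
    · exact hpm (Int.natCast_dvd.mpr h)
  obtain ⟨b, hb1, hb2⟩ := Nat.chineseRemainder hcop r.val 1
  have hb4 : b % 4 = 1 := hb2.of_dvd ⟨m.natAbs, rfl⟩
  have hpb : J((p : ℤ) | b) = -1 := by
    rw [jacobiSym.quadratic_reciprocity_one_mod_four' (hp.odd_of_ne_two hp2) hb4,
      ZMod.nonsquare_iff_jacobiSym_eq_neg_one]
    have : (b : ZMod p) = r := by
      rw [(ZMod.natCast_eq_natCast_iff _ _ _).mpr hb1, ZMod.natCast_zmod_val]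
    simpa [this] using hr
  refine ⟨b, Nat.odd_iff.mpr (by lia), ?_⟩
  rw [jacobiSym.mul_left, jacobiSym.pow_left, hpb, jacobiSym_eq_one_of_modEq_one hm hb2,
    hk.neg_one_pow, mul_one]

lemma exists_jacobiSym_eq_neg_one {n : ℤ} (hn : n ≠ 0) (hsq : ¬ IsSquare n) :
    ∃ b : ℕ, Odd b ∧ J(n | b) = -1 := by
  by_cases H : ∃ p : ℕ, p.Prime ∧ p ≠ 2 ∧ Odd (n.natAbs.factorization p)
  · obtain ⟨p, hp, hp2, hodd⟩ := H
    obtain ⟨m, hm⟩ := Int.natCast_dvd.mpr (Nat.ordProj_dvd n.natAbs p)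
    have hpm : ¬ (p : ℤ) ∣ m := by
      rintro ⟨c, rfl⟩
      refine Nat.pow_succ_factorization_not_dvd (Int.natAbs_ne_zero.mpr hn) hp
        (Int.natCast_dvd.mp ⟨c, ?_⟩)
      conv_lhs => rw [hm]
      push_cast
      ring
    obtain ⟨b, hb, h⟩ := exists_jacobiSym_eq_neg_one_of_odd_pow hp hp2 hodd hpm
    exact ⟨b, hb, by rw [hm]; push_cast; exact h⟩
  push Not at H
  obtain ⟨k, m, hm2, hkm⟩ := Nat.exists_eq_two_pow_mul_odd (Int.natAbs_ne_zero.mpr hn)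
  have hm0 : m ≠ 0 := by rintro rfl; simp at hm2
  have hmsq : IsSquare m := by
    rw [← Nat.prod_factorization_pow_eq_self hm0]
    refine Finset.isSquare_prod _ fun p hp ↦ Even.isSquare_pow ?_ _
    have hpp : p.Prime := Nat.prime_of_mem_primeFactors hp
    have hp2 : p ≠ 2 := by
      rintro rfl
      exact (Nat.not_even_iff_odd.mpr hm2) (even_iff_two_dvd.mpr (Nat.dvd_of_mem_primeFactors hp))
    have := H p hpp hp2
    rw [hkm, Nat.factorization_mul (by positivity) hm0, Nat.Prime.factorization_pow
      Nat.prime_two] at this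
    simpa [hp2.symm] using this
  obtain ⟨c, rfl⟩ := hmsq
  have hc : Odd c := (Nat.odd_mul.mp hm2).1
  obtain ⟨ε, hε, hnε⟩ : ∃ ε : ℤ, (ε = 1 ∨ ε = -1) ∧ n = ε * (2 ^ k * (c : ℤ) ^ 2) := by
    rcases Int.natAbs_eq n with h | h
    · exact ⟨1, .inl rfl, by rw [h, hkm]; push_cast; ring⟩
    · exact ⟨-1, .inr rfl, by rw [h, hkm]; push_cast; ring⟩
  rcases Nat.even_or_odd k with hk | hk
  · have hε' : ε = -1 := by
      refine hε.resolve_left fun h ↦ hsq ?_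
      obtain ⟨j, rfl⟩ := hk
      exact ⟨2 ^ j * c, by rw [hnε, h]; ring⟩
    have hb4 : (4 * c ^ 2 - 1) % 4 = 3 := by
      have : 0 < c ^ 2 := by have := hc.pos; positivity
      lia
    have hodd : Odd (4 * c ^ 2 - 1) := Nat.odd_iff.mpr (by lia)
    have hcop : IsCoprime (2 ^ (k / 2) * (c : ℤ)) ((4 * c ^ 2 - 1 : ℕ) : ℤ) := by
      have hc1 : IsCoprime (2 * (c : ℤ)) ((4 * c ^ 2 - 1 : ℕ) : ℤ) := by
        refine ⟨2 * c, -1, ?_⟩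
        rw [Nat.cast_sub (by have := hc.pos; nlinarith)]
        push_cast
        ring
      exact (hc1.of_mul_left_left.pow_left).mul_left hc1.of_mul_left_right
    refine ⟨_, hodd, ?_⟩
    have hk2 : 2 ^ k * (c : ℤ) ^ 2 = (2 ^ (k / 2) * (c : ℤ)) ^ 2 := by
      rw [mul_pow, ← pow_mul, Nat.div_mul_cancel hk.two_dvd]
    rw [hnε, hε', jacobiSym.mul_left, hk2, jacobiSym.sq_one' (Int.isCoprime_iff_gcd_eq_one.mp hcop),
      mul_one, jacobiSym.at_neg_one hodd, ZMod.χ₄_nat_three_mod_four hb4]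
  · have hb8 : (4 + c ^ 2) % 8 = 5 := by
      have := Nat.odd_mod_four_iff.mp (Nat.odd_iff.mp hc)
      have : c % 8 = 1 ∨ c % 8 = 3 ∨ c % 8 = 5 ∨ c % 8 = 7 := by lia
      rcases this with h | h | h | h <;> simp [Nat.add_mod, Nat.pow_mod, h]
    have hodd : Odd (4 + c ^ 2) := Nat.odd_iff.mpr (by lia)
    have hcop : IsCoprime (c : ℤ) ((4 + c ^ 2 : ℕ) : ℤ) := by
      have h2 : IsCoprime (c : ℤ) 4 := by
        have := (Nat.Coprime.pow_right 2 (Nat.coprime_two_right.mpr hc)).isCoprime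
        simpa using this
      have := h2.add_mul_left_right (c : ℤ)
      push_cast
      rwa [sq]
    refine ⟨_, hodd, ?_⟩
    have hεb : J(ε | 4 + c ^ 2) = 1 := by
      rcases hε with rfl | rfl
      · exact jacobiSym.one_left _
      · rw [jacobiSym.at_neg_one hodd, ZMod.χ₄_nat_one_mod_four (by lia)]
    rw [hnε, jacobiSym.mul_left, jacobiSym.mul_left, hεb,
      jacobiSym.sq_one' (Int.isCoprime_iff_gcd_eq_one.mp hcop), jacobiSym.pow_left,
      jacobiSym.at_two hodd, ZMod.χ₈_nat_eq_if_mod_eight, if_neg (by lia), if_neg (by lia),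
      hk.neg_one_pow]
    norm_num

lemma odd_of_coprime_four_mul {b m : ℕ} (h : b.Coprime (4 * m)) : Odd b := by
  have : b.Coprime 2 := h.coprime_dvd_right ⟨2 * m, by ring⟩
  simpa using this

/-- The Jacobi symbols `J(n | a)` for `a` running over the units modulo `4 |n|` sum to zero. -/
lemma sum_units_jacobiSym_eq_zero {n : ℤ} (hn : n ≠ 0) (hsq : ¬ IsSquare n)
    [NeZero (4 * n.natAbs)] :
    ∑ a : (ZMod (4 * n.natAbs))ˣ, J(n | (a : ZMod (4 * n.natAbs)).val) = 0 := by
  obtain ⟨b, hodd, hb⟩ := exists_jacobiSym_eq_neg_one hn hsq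
  have hcop : b.Coprime (4 * n.natAbs) := by
    refine Nat.Coprime.mul_right ?_ ?_
    · exact Nat.Coprime.pow_right 2 (Nat.coprime_two_right.mpr hodd)
    · by_contra h
      have := jacobiSym.eq_zero_iff.mpr ⟨hodd.pos.ne', fun h' ↦ h (Nat.coprime_comm.mp h')⟩
      rw [hb] at this
      norm_num at this
  have hmul (a : (ZMod (4 * n.natAbs))ˣ) :
      J(n | ((ZMod.unitOfCoprime b hcop * a : (ZMod (4 * n.natAbs))ˣ) :
        ZMod (4 * n.natAbs)).val) = -J(n | (a : ZMod (4 * n.natAbs)).val) := by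
    have ha := odd_of_coprime_four_mul (ZMod.val_coe_unit_coprime a)
    rw [Units.val_mul, ZMod.coe_unitOfCoprime, ZMod.val_mul, ZMod.val_natCast, Nat.mod_mul_mod,
      ← jacobiSym.mod_right n (hodd.mul ha), jacobiSym.mul_right' n hodd.pos.ne' ha.pos.ne', hb,
      neg_one_mul]
  have hsum := Equiv.sum_comp (Equiv.mulLeft (ZMod.unitOfCoprime b hcop))
    fun a : (ZMod (4 * n.natAbs))ˣ ↦ J(n | (a : ZMod (4 * n.natAbs)).val)
  simp only [Equiv.coe_mulLeft, hmul, Finset.sum_neg_distrib] at hsum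
  lia

lemma sum_units_jacobiSym_mul_residueClass (n : ℤ) [NeZero (4 * n.natAbs)] (k : ℕ) :
    ∑ a : (ZMod (4 * n.natAbs))ˣ, (J(n | (a : ZMod (4 * n.natAbs)).val) : ℝ) *
      ArithmeticFunction.vonMangoldt.residueClass (a : ZMod (4 * n.natAbs)) k =
    if k.Coprime (4 * n.natAbs) then J(n | k) * ArithmeticFunction.vonMangoldt k else 0 := by
  split_ifs with hk
  · rw [Finset.sum_eq_single (ZMod.unitOfCoprime k hk)]
    · rw [ZMod.coe_unitOfCoprime, ZMod.val_natCast,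
        ← jacobiSym.mod_right n (odd_of_coprime_four_mul hk),
        ArithmeticFunction.vonMangoldt.residueClass, indicator_of_mem (by simp)]
    · intro a _ ha
      rw [ArithmeticFunction.vonMangoldt.residueClass, indicator_of_notMem, mul_zero]
      intro h
      exact ha (Units.ext (by simpa using h.symm))
    · simp
  · refine Finset.sum_eq_zero fun a _ ↦ ?_
    rw [ArithmeticFunction.vonMangoldt.residueClass, indicator_of_notMem, mul_zero]
    intro h
    have h' : (k : ZMod (4 * n.natAbs)) = a := h
    exact hk ((ZMod.isUnit_iff_coprime _ _).mp (h' ▸ a.isUnit))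

lemma abs_jacobiSym_le_one (n : ℤ) (k : ℕ) : |(J(n | k) : ℝ)| ≤ 1 := by
  rcases jacobiSym.trichotomy n k with h | h | h <;> simp [h]

/-- The twisted Chebyshev function `∑ J(n | k) Λ(k)` is `o(Z)` when `n` is not a square. -/
lemma tendsto_sum_jacobiSym_mul_vonMangoldt_div {n : ℤ} (hn : n ≠ 0) (hsq : ¬ IsSquare n) :
    Tendsto (fun Z : ℕ ↦ (∑ k ∈ Finset.Icc 1 Z, if k.Coprime (4 * n.natAbs) then
      (J(n | k) : ℝ) * ArithmeticFunction.vonMangoldt k else 0) / Z) atTop (𝓝 0) := by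
  have : NeZero (4 * n.natAbs) := ⟨by simpa using hn⟩
  have hlim : Tendsto (fun Z : ℕ ↦ ∑ a : (ZMod (4 * n.natAbs))ˣ,
      (J(n | (a : ZMod (4 * n.natAbs)).val) : ℝ) * ((∑ k ∈ Finset.Icc 1 Z,
        ArithmeticFunction.vonMangoldt.residueClass (a : ZMod (4 * n.natAbs)) k) / Z)) atTop
      (𝓝 (∑ a : (ZMod (4 * n.natAbs))ˣ, (J(n | (a : ZMod (4 * n.natAbs)).val) : ℝ) *
        ((4 * n.natAbs).totient : ℝ)⁻¹)) :=
    tendsto_finsetSum _ fun a _ ↦ (tendsto_sum_residueClass_div a.isUnit).const_mul _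
  have hzero : (∑ a : (ZMod (4 * n.natAbs))ˣ, (J(n | (a : ZMod (4 * n.natAbs)).val) : ℝ)) = 0 := by
    exact_mod_cast sum_units_jacobiSym_eq_zero hn hsq
  rw [← Finset.sum_mul, hzero, zero_mul] at hlim
  refine hlim.congr fun Z ↦ ?_
  simp_rw [← sum_units_jacobiSym_mul_residueClass]
  rw [Finset.sum_comm, Finset.sum_div]
  refine Finset.sum_congr rfl fun a _ ↦ ?_
  rw [← Finset.mul_sum, mul_div_assoc]

lemma Nat.Prime.coprime_four_mul_natAbs_iff {p : ℕ} (hp : p.Prime) (n : ℤ) :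
    p.Coprime (4 * n.natAbs) ↔ ¬ (p : ℤ) ∣ 2 * n := by
  rw [hp.coprime_iff_not_dvd, Int.natCast_dvd, Int.natAbs_mul, hp.dvd_mul, hp.dvd_mul,
    show (4 : ℕ) = 2 ^ 2 by norm_num, hp.prime.dvd_pow_iff_dvd two_ne_zero]
  rfl

/-- Passing from the twisted Chebyshev function to the sum of Jacobi symbols over primes. -/
lemma abs_sum_jacobiSym_mul_log_le (n : ℤ) (Z : ℕ) :
    |∑ p ∈ (Finset.range (Z + 1)).filter (fun p : ℕ ↦ p.Prime ∧ ¬ (p : ℤ) ∣ 2 * n),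
      (J(n | p) : ℝ)| * Real.log Z ≤
    |∑ k ∈ Finset.Icc 1 Z, if k.Coprime (4 * n.natAbs) then
      (J(n | k) : ℝ) * ArithmeticFunction.vonMangoldt k else 0| +
    (Chebyshev.psi Z - Chebyshev.theta Z) +
    (Nat.primeCounting Z * Real.log Z - Chebyshev.theta Z) := by
  set P := (Finset.range (Z + 1)).filter (fun p : ℕ ↦ p.Prime ∧ ¬ (p : ℤ) ∣ 2 * n)
  set w : ℕ → ℝ := fun k ↦ if k.Coprime (4 * n.natAbs) then
      (J(n | k) : ℝ) * ArithmeticFunction.vonMangoldt k else 0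
  have hlogZ : 0 ≤ Real.log Z := Real.log_natCast_nonneg Z
  have hw (k : ℕ) : |w k| ≤ ArithmeticFunction.vonMangoldt k := by
    simp only [w]
    split_ifs
    · rw [abs_mul, abs_of_nonneg ArithmeticFunction.vonMangoldt_nonneg]
      exact mul_le_of_le_one_left ArithmeticFunction.vonMangoldt_nonneg (abs_jacobiSym_le_one n k)
    · simp
  have hwP : ∑ k ∈ Finset.Icc 1 Z with k.Prime, w k = ∑ p ∈ P, (J(n | p) : ℝ) * Real.log p := by
    rw [Finset.sum_filter, Finset.sum_filter, Finset.range_eq_Ico,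
      Finset.sum_eq_sum_Ico_succ_bot (by lia)]
    simp only [Nat.not_prime_zero, false_and, if_false, zero_add]
    rw [Finset.Ico_add_one_right_eq_Icc]
    refine Finset.sum_congr rfl fun p _ ↦ ?_
    by_cases hp : p.Prime
    · simp only [w, hp, if_true, true_and, hp.coprime_four_mul_natAbs_iff,
        ArithmeticFunction.vonMangoldt_apply_prime hp]
    · simp [hp]
  have hnotprime : |∑ k ∈ Finset.Icc 1 Z with ¬ k.Prime, w k| ≤
      Chebyshev.psi Z - Chebyshev.theta Z := by
    rw [Chebyshev.psi_sub_theta_eq_sum_not_prime, Nat.floor_natCast,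
      ← Finset.Icc_add_one_left_eq_Ioc]
    exact (Finset.abs_sum_le_sum_abs _ _).trans (Finset.sum_le_sum fun k _ ↦ hw k)
  have hsplit := Finset.sum_filter_add_sum_filter_not (Finset.Icc 1 Z) (fun k ↦ k.Prime) w
  have hlog : |∑ p ∈ P, (J(n | p) : ℝ) * (Real.log Z - Real.log p)| ≤
      Nat.primeCounting Z * Real.log Z - Chebyshev.theta Z := by
    have hPsub : P ⊆ Nat.primesLE Z := by
      rw [Nat.primesLE_eq_filter_range]
      exact Finset.monotone_filter_right _ fun p _ hp ↦ hp.1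
    have hle (p : ℕ) (hp : p ∈ Nat.primesLE Z) : 0 ≤ Real.log Z - Real.log p := by
      rw [Nat.primesLE_eq_filter_range, Finset.mem_filter, Finset.mem_range] at hp
      rw [sub_nonneg]
      have := hp.2.pos
      exact Real.log_le_log (by exact_mod_cast this) (by exact_mod_cast Nat.lt_succ_iff.mp hp.1)
    calc
      _ ≤ ∑ p ∈ P, (Real.log Z - Real.log p) := by
        refine (Finset.abs_sum_le_sum_abs _ _).trans (Finset.sum_le_sum fun p hp ↦ ?_)
        rw [abs_mul, abs_of_nonneg (hle p (hPsub hp))]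
        exact mul_le_of_le_one_left (hle p (hPsub hp)) (abs_jacobiSym_le_one n p)
      _ ≤ ∑ p ∈ Nat.primesLE Z, (Real.log Z - Real.log p) :=
        Finset.sum_le_sum_of_subset_of_nonneg hPsub fun p hp _ ↦ hle p hp
      _ = _ := by
        rw [Finset.sum_sub_distrib, ← Chebyshev.theta_eq_sum_primesLE_log, Finset.sum_const,
          Nat.primesLE_card_eq_primeCounting, nsmul_eq_mul]
  have hdecomp : (∑ p ∈ P, (J(n | p) : ℝ)) * Real.log Z =
      ∑ k ∈ Finset.Icc 1 Z, w k - ∑ k ∈ Finset.Icc 1 Z with ¬ k.Prime, w k +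
        ∑ p ∈ P, (J(n | p) : ℝ) * (Real.log Z - Real.log p) := by
    rw [← hsplit, hwP, add_sub_cancel_right, ← Finset.sum_add_distrib, Finset.sum_mul]
    refine Finset.sum_congr rfl fun p _ ↦ ?_
    ring
  rw [← abs_of_nonneg hlogZ, ← abs_mul, abs_of_nonneg hlogZ, hdecomp]
  refine (abs_add_le _ _).trans (add_le_add ((abs_sub _ _).trans ?_) hlog)
  gcongr

lemma tendsto_psi_sub_theta_div :
    Tendsto (fun x : ℝ ↦ (Chebyshev.psi x - Chebyshev.theta x) / x) atTop (𝓝 0) := by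
  refine (Chebyshev.isBigO_psi_sub_theta_sqrt.trans_isLittleO ?_).tendsto_div_nhds_zero
  refine (Asymptotics.isLittleO_iff_tendsto' ?_).mpr ?_
  · filter_upwards [eventually_ne_atTop 0] with x hx h using absurd h hx
  · simp only [Real.sqrt_div_self]
    exact Real.tendsto_sqrt_atTop.inv_tendsto_atTop.congr fun x ↦ by simp

lemma tendsto_primeCounting_mul_log_sub_theta_div :
    Tendsto (fun x : ℝ ↦ (Nat.primeCounting ⌊x⌋₊ * Real.log x - Chebyshev.theta x) / x)
      atTop (𝓝 0) := by
  have h1 := Chebyshev.primeCounting_sub_theta_div_log_isBigO.mul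
    (Asymptotics.isBigO_refl (fun x : ℝ ↦ Real.log x / x) atTop)
  have h2 : Tendsto (fun x : ℝ ↦ x / Real.log x ^ 2 * (Real.log x / x)) atTop (𝓝 0) := by
    refine Real.tendsto_log_atTop.inv_tendsto_atTop.congr' ?_
    filter_upwards [eventually_gt_atTop 1] with x hx
    have := Real.log_pos hx
    simp only [Pi.inv_apply]
    field_simp
  refine (h1.trans_tendsto h2).congr' ?_
  filter_upwards [eventually_gt_atTop 1] with x hx
  have := Real.log_pos hx
  field_simp

lemma eventually_mul_le_primeCounting_mul_log :
    ∀ᶠ Z : ℕ in atTop, Real.log 2 / 2 * Z ≤ Nat.primeCounting Z * Real.log Z := by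
  have hlog : (fun x : ℝ ↦ Real.log (x + 1)) =o[atTop] fun x ↦ x + 1 :=
    Real.isLittleO_log_id_atTop.comp_tendsto (tendsto_atTop_add_const_right _ 1 tendsto_id)
  have hpos : 0 < Real.log 2 / 4 := by have := Real.log_pos one_lt_two; positivity
  have hev := tendsto_natCast_atTop_atTop.eventually (hlog.bound hpos)
  filter_upwards [hev, eventually_ge_atTop 1] with Z hZ hZ1
  have hZ1' : (1 : ℝ) ≤ Z := by exact_mod_cast hZ1
  have h1 := Chebyshev.psi_le_primeCounting_mul_log Z
  have h2 := Chebyshev.psi_ge Z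
  rw [Real.norm_of_nonneg (Real.log_nonneg (by linarith)), Real.norm_of_nonneg (by linarith)] at hZ
  nlinarith

/-- Let `n` be a nonzero integer which is not a perfect square.  Then
`∑_{p ≤ Z, p prime, p ∤ 2n} (n/p) = o(π(Z))` as `Z → ∞`, the Legendre symbols being
expressed as Jacobi symbols. -/
theorem stmt_12 (n : ℤ) (hn : n ≠ 0) (hsq : ¬ IsSquare n) :
    Filter.Tendsto
      (fun Z : ℕ =>
        (∑ p ∈ (Finset.range (Z + 1)).filter
            (fun p : ℕ => p.Prime ∧ ¬ (p : ℤ) ∣ 2 * n),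
          (jacobiSym n p : ℝ)) /
        (((Finset.range (Z + 1)).filter Nat.Prime).card : ℝ))
      Filter.atTop (nhds 0) := by
  have hcast := tendsto_natCast_atTop_atTop (R := ℝ)
  have hbound := (((tendsto_sum_jacobiSym_mul_vonMangoldt_div hn hsq).abs.add
    (tendsto_psi_sub_theta_div.comp hcast)).add
    (tendsto_primeCounting_mul_log_sub_theta_div.comp hcast)).mul_const (Real.log 2 / 2)⁻¹
  simp only [abs_zero, add_zero, zero_mul] at hbound
  refine squeeze_zero_norm' ?_ hbound
  filter_upwards [eventually_mul_le_primeCounting_mul_log, eventually_gt_atTop 1] with Z hZ hZ1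
  have hZ0 : (0 : ℝ) < Z := by exact_mod_cast zero_lt_one.trans hZ1
  have hlogZ : 0 < Real.log Z := Real.log_pos (by exact_mod_cast hZ1)
  have hlog2 : 0 < Real.log 2 := Real.log_pos one_lt_two
  have hcard : ((Finset.range (Z + 1)).filter Nat.Prime).card = Nat.primeCounting Z := by
    rw [← Nat.primesLE_eq_filter_range, Nat.primesLE_card_eq_primeCounting]
  have key := abs_sum_jacobiSym_mul_log_le n Z
  rw [hcard, norm_div, Real.norm_eq_abs, Real.norm_natCast,
    ← mul_div_mul_right _ _ hlogZ.ne']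
  simp only [Function.comp_apply, Nat.floor_natCast]
  rw [abs_div, abs_of_pos hZ0, ← add_div, ← add_div, ← div_eq_mul_inv, div_div, mul_comm (Z : ℝ)]
  have := (mul_nonneg (abs_nonneg _) hlogZ.le).trans key
  gcongr
end

section
/- Let K be a number field with ring of integers 𝓞_K, and let α₁, …, α_k be nonzero elements of 𝓞_K that are multiplicatively independent. Then there exists a constant C > 0 (depending on the αᵢ and K) such that for every real y ≥ 1, the number of nonzero prime ideals P of 𝓞_K with αᵢ ∉ P for all i and such that the subgroup of the unit group (𝓞_K/P)ˣ generated by the images of α₁, …, α_k has cardinality less than y, is at most C·y^{1 + 1/k}. -/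
set_option synthInstance.maxHeartbeats 1000000
set_option maxHeartbeats 1000000

open NumberField

/-- In a commutative group, a multiplicative relation is an equality of two monomials with natural
exponents. -/
theorem prod_zpow_eq_one_iff_prod_toNat_eq {G ι : Type*} [CommGroup G] [Fintype ι]
    (u : ι → G) (n : ι → ℤ) :
    ∏ i, u i ^ n i = 1 ↔ ∏ i, u i ^ (n i).toNat = ∏ i, u i ^ (-n i).toNat := by
  have h (i : ι) : u i ^ n i = u i ^ (n i).toNat / u i ^ (-n i).toNat := by
    rw [← zpow_natCast, ← zpow_natCast, div_eq_mul_inv, ← zpow_sub]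
    congr 1
    omega
  simp only [h, Finset.prod_div_distrib, div_eq_one]

/-- The difference of the two monomials attached to an exponent vector `n`. It vanishes exactly when
`n` is a multiplicative relation between the `α i`. -/
def monomialDiff {R ι : Type*} [CommRing R] [Fintype ι] (α : ι → R) (n : ι → ℤ) : R :=
  ∏ i, α i ^ (n i).toNat - ∏ i, α i ^ (-n i).toNat

theorem map_monomialDiff {R S ι : Type*} [CommRing R] [CommRing S] [Fintype ι] (f : R →+* S)
    (α : ι → R) (n : ι → ℤ) :
    f (monomialDiff α n) = monomialDiff (fun i ↦ f (α i)) n := by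
  simp [monomialDiff]

theorem monomialDiff_units_eq_zero_iff {R ι : Type*} [CommRing R] [Fintype ι] (u : ι → Rˣ)
    (n : ι → ℤ) : monomialDiff (fun i ↦ (u i : R)) n = 0 ↔ ∏ i, u i ^ n i = 1 := by
  rw [prod_zpow_eq_one_iff_prod_toNat_eq, monomialDiff, sub_eq_zero, Units.ext_iff]
  simp

theorem norm_monomialDiff_le {ι : Type*} [Fintype ι] (z : ι → ℂ) (a N : ℕ)
    (hz : ∀ i, ‖z i‖ ≤ 2 ^ a) (n : ι → ℤ) (hn : ∀ i, |n i| ≤ N) :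
    ‖monomialDiff z n‖ ≤ 2 ^ (a * N * Fintype.card ι + 1) := by
  have key (e : ι → ℕ) (he : ∀ i, e i ≤ N) :
      ‖∏ i, z i ^ e i‖ ≤ 2 ^ (a * N * Fintype.card ι) := by
    rw [norm_prod]
    calc ∏ i, ‖z i ^ e i‖ ≤ ∏ _i : ι, (2 : ℝ) ^ (a * N) := by
          refine Finset.prod_le_prod (fun i _ ↦ norm_nonneg _) fun i _ ↦ ?_
          rw [norm_pow]
          calc ‖z i‖ ^ e i ≤ (2 ^ a) ^ e i := by gcongr; exact hz i
            _ ≤ (2 ^ a) ^ N := pow_le_pow_right₀ (one_le_pow₀ one_le_two) (he i)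
            _ = 2 ^ (a * N) := (pow_mul _ _ _).symm
      _ = 2 ^ (a * N * Fintype.card ι) := by
          rw [Finset.prod_const, Finset.card_univ, ← pow_mul]
  have h₁ := key (fun i ↦ (n i).toNat) fun i ↦ by have := abs_le.mp (hn i); omega
  have h₂ := key (fun i ↦ (-n i).toNat) fun i ↦ by have := abs_le.mp (hn i); omega
  calc ‖monomialDiff z n‖ ≤ _ := norm_sub_le _ _
    _ ≤ 2 ^ (a * N * Fintype.card ι + 1) := by rw [pow_succ]; linarith

theorem exists_le_two_pow {ι : Type*} [Finite ι] (f : ι → ℝ) :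
    ∃ a : ℕ, ∀ i, f i ≤ 2 ^ a := by
  obtain ⟨M, hM⟩ := Set.Finite.bddAbove (Set.finite_range f)
  obtain ⟨a, ha⟩ := pow_unbounded_of_one_lt M (one_lt_two (α := ℝ))
  exact ⟨a, fun i ↦ (hM ⟨i, rfl⟩).trans ha.le⟩

/-- An algebraic integer all of whose conjugates are bounded by `2 ^ m` generates an ideal of norm
at most `2 ^ (m * [K : ℚ])`. -/
theorem absNorm_span_singleton_le_two_pow {K : Type*} [Field K] [NumberField K] (β : 𝓞 K) (m : ℕ)
    (hβ : ∀ σ : K →ₐ[ℚ] ℂ, ‖σ β‖ ≤ 2 ^ m) :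
    Ideal.absNorm (Ideal.span {β}) ≤ 2 ^ (m * Module.finrank ℚ K) := by
  have h : ((Ideal.absNorm (Ideal.span {β}) : ℕ) : ℝ) = ∏ σ : K →ₐ[ℚ] ℂ, ‖σ β‖ := by
    rw [← norm_prod, ← Algebra.norm_eq_prod_embeddings ℚ ℂ (β : K), ← Algebra.coe_norm_int,
      Ideal.absNorm_span_singleton, Nat.cast_natAbs]
    simp
  have h' : ((Ideal.absNorm (Ideal.span {β}) : ℕ) : ℝ) ≤ 2 ^ (m * Module.finrank ℚ K) := by
    rw [h, pow_mul, ← AlgHom.card ℚ K ℂ, ← Finset.card_univ, ← Finset.prod_const]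
    exact Finset.prod_le_prod (fun σ _ ↦ norm_nonneg _) fun σ _ ↦ hβ σ
  exact_mod_cast h'

theorem card_primes_le_of_absNorm_le {K : Type*} [Field K] [NumberField K] {I : Ideal (𝓞 K)}
    (hI : I ≠ ⊥) {m : ℕ} (hm : Ideal.absNorm I ≤ 2 ^ m) (T : Finset (Ideal (𝓞 K)))
    (hT : ∀ P ∈ T, P.IsPrime ∧ P ≠ ⊥ ∧ I ≤ P) : T.card ≤ m := by
  have hdvd : ∏ P ∈ T, P ∣ I := Finset.prod_primes_dvd I
    (fun P hP ↦ Ideal.prime_of_isPrime (hT P hP).2.1 (hT P hP).1)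
    fun P hP ↦ Ideal.dvd_iff_le.mpr (hT P hP).2.2
  have hpos : 0 < Ideal.absNorm I := Nat.pos_of_ne_zero (mt Ideal.absNorm_eq_zero_iff.mp hI)
  have hle : ∏ P ∈ T, Ideal.absNorm P ≤ Ideal.absNorm I := by
    rw [← map_prod]
    exact Nat.le_of_dvd hpos (map_dvd Ideal.absNorm hdvd)
  have htwo : 2 ^ T.card ≤ ∏ P ∈ T, Ideal.absNorm P := by
    refine Finset.pow_card_le_prod T _ 2 fun P hP ↦ ?_
    have h0 : Ideal.absNorm P ≠ 0 := mt Ideal.absNorm_eq_zero_iff.mp (hT P hP).2.1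
    have h1 : Ideal.absNorm P ≠ 1 := mt Ideal.absNorm_eq_one_iff.mp (hT P hP).1.ne_top
    omega
  exact (Nat.pow_le_pow_iff_right one_lt_two).mp (htwo.trans (hle.trans hm))

theorem exists_finset_primes_mem {K : Type*} [Field K] [NumberField K] {β : 𝓞 K} (hβ : β ≠ 0)
    {m : ℕ} (hm : Ideal.absNorm (Ideal.span {β}) ≤ 2 ^ m) :
    ∃ T : Finset (Ideal (𝓞 K)), T.card ≤ m ∧
      ∀ P : Ideal (𝓞 K), P.IsPrime → P ≠ ⊥ → β ∈ P → P ∈ T := by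
  have hI : Ideal.span {β} ≠ ⊥ := mt Ideal.span_singleton_eq_bot.mp hβ
  have hcard (T : Finset (Ideal (𝓞 K)))
      (hT : (T : Set (Ideal (𝓞 K))) ⊆ {P | P.IsPrime ∧ P ≠ ⊥ ∧ Ideal.span {β} ≤ P}) :
      T.card ≤ m :=
    card_primes_le_of_absNorm_le hI hm T fun _ hP ↦ hT hP
  have hfin : {P : Ideal (𝓞 K) | P.IsPrime ∧ P ≠ ⊥ ∧ Ideal.span {β} ≤ P}.Finite := by
    by_contra hinf
    obtain ⟨T, hT, hTm⟩ := Set.Infinite.exists_subset_card_eq hinf (m + 1)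
    have := hcard T hT
    omega
  refine ⟨hfin.toFinset, hcard _ (by simp), fun P h₁ h₂ h₃ ↦ ?_⟩
  simpa using ⟨h₁, h₂, h₃⟩

/-- If the group generated by `k` elements has fewer than `N ^ k` elements, then these elements
satisfy a nontrivial relation with exponents bounded by `N`. -/
theorem exists_zpow_relation_of_card_closure_lt {G ι : Type*} [CommGroup G] [Finite G] [Fintype ι]
    (u : ι → G) {s : Set G} (hu : ∀ i, u i ∈ s) {N : ℕ}
    (hN : Nat.card (Subgroup.closure s) < N ^ Fintype.card ι) :
    ∃ n : ι → ℤ, n ≠ 0 ∧ (∀ i, |n i| ≤ N) ∧ ∏ i, u i ^ n i = 1 := by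
  classical
  have := Fintype.ofFinite (Subgroup.closure s)
  let f : (ι → Fin N) → Subgroup.closure s := fun a ↦
    ⟨∏ i, u i ^ (a i : ℕ),
      Subgroup.prod_mem _ fun i _ ↦ Subgroup.pow_mem _ (Subgroup.subset_closure (hu i)) _⟩
  obtain ⟨a, b, hab, hf⟩ := Fintype.exists_ne_map_eq_of_card_lt f (by
    rwa [← Nat.card_eq_fintype_card, Fintype.card_fun, Fintype.card_fin])
  refine ⟨fun i ↦ (a i : ℤ) - b i, fun h ↦ hab ?_, fun i ↦ ?_, ?_⟩
  · funext i
    have := congrFun h i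
    simp only [Pi.zero_apply] at this
    exact Fin.ext (by omega)
  · have := (a i).isLt
    have := (b i).isLt
    exact abs_le.mpr ⟨by dsimp only; omega, by dsimp only; omega⟩
  · have hf' : ∏ i, u i ^ (a i : ℕ) = ∏ i, u i ^ (b i : ℕ) := congrArg Subtype.val hf
    simp only [zpow_sub, zpow_natCast, ← div_eq_mul_inv, Finset.prod_div_distrib, hf', div_self']

theorem monomialDiff_ne_zero {K : Type*} [Field K] {ι : Type*} [Fintype ι]
    (α : ι → 𝓞 K) (hα : ∀ i, α i ≠ 0)
    (hind : ∀ n : ι → ℤ, ∏ i, ((α i : K) ^ n i) = 1 → ∀ i, n i = 0) {n : ι → ℤ} (hn : n ≠ 0) :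
    monomialDiff α n ≠ 0 := by
  intro h
  have hα' (i : ι) : (α i : K) ≠ 0 := RingOfIntegers.coe_ne_zero_iff.mpr (hα i)
  have h' := congrArg (algebraMap (𝓞 K) K) h
  rw [map_monomialDiff, map_zero] at h'
  have h₁ := (monomialDiff_units_eq_zero_iff (fun i ↦ Units.mk0 _ (hα' i)) n).mp h'
  refine hn (funext (hind n ?_))
  simpa using congrArg Units.val h₁

/-- A prime at which the reductions of the `α i` generate a group of order less than `N ^ k`
contains one of the elements `monomialDiff α n` with `n` bounded by `N`. -/
theorem exists_monomialDiff_mem {K : Type*} [Field K] [NumberField K] {ι : Type*} [Fintype ι]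
    (α : ι → 𝓞 K) {P : Ideal (𝓞 K)} (hP : P.IsPrime) (hbot : P ≠ ⊥) (hαP : ∀ i, α i ∉ P) {N : ℕ}
    (hN : Nat.card (Subgroup.closure
      {x : (𝓞 K ⧸ P)ˣ | ∃ i, (x : 𝓞 K ⧸ P) = Ideal.Quotient.mk P (α i)}) < N ^ Fintype.card ι) :
    ∃ n : ι → ℤ, n ≠ 0 ∧ (∀ i, |n i| ≤ N) ∧ monomialDiff α n ∈ P := by
  have : Finite (𝓞 K ⧸ P) := Ideal.finiteQuotientOfFreeOfNeBot P hbot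
  have hfield : IsField (𝓞 K ⧸ P) := Finite.isField_of_domain _
  have hunit (i : ι) : IsUnit (Ideal.Quotient.mk P (α i)) := by
    obtain ⟨b, hb⟩ := hfield.mul_inv_cancel (mt Ideal.Quotient.eq_zero_iff_mem.mp (hαP i))
    exact IsUnit.of_mul_eq_one b hb
  choose u hu using hunit
  obtain ⟨n, hn, hbound, hrel⟩ :=
    exists_zpow_relation_of_card_closure_lt u
      (s := {x | ∃ i, (x : 𝓞 K ⧸ P) = Ideal.Quotient.mk P (α i)}) (fun i ↦ ⟨i, hu i⟩) hN
  refine ⟨n, hn, hbound, Ideal.Quotient.eq_zero_iff_mem.mp ?_⟩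
  rw [map_monomialDiff]
  simp only [← hu]
  exact (monomialDiff_units_eq_zero_iff u n).mpr hrel

/-- There is a constant `c` such that, for all `N ≥ 1`, the primes containing some nonzero
`monomialDiff α n` with `n` bounded by `N` lie in a set of at most `(2 * N + 1) ^ k * (c * N)`
elements. -/
theorem exists_finset_primes_monomialDiff_mem {K : Type*} [Field K] [NumberField K] {ι : Type*}
    [Fintype ι] (α : ι → 𝓞 K) (hα : ∀ n : ι → ℤ, n ≠ 0 → monomialDiff α n ≠ 0) :
    ∃ c : ℕ, ∀ N : ℕ, 0 < N → ∃ T : Finset (Ideal (𝓞 K)),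
      T.card ≤ (2 * N + 1) ^ Fintype.card ι * (c * N) ∧
      ∀ P : Ideal (𝓞 K), P.IsPrime → P ≠ ⊥ →
        ∀ n : ι → ℤ, n ≠ 0 → (∀ i, |n i| ≤ N) → monomialDiff α n ∈ P → P ∈ T := by
  classical
  obtain ⟨a, ha⟩ := exists_le_two_pow
    fun p : (K →ₐ[ℚ] ℂ) × ι ↦ ‖p.1 (α p.2)‖
  refine ⟨(a * Fintype.card ι + 1) * Module.finrank ℚ K, fun N hN ↦ ?_⟩
  have hprimes (n : ι → ℤ) : ∃ T : Finset (Ideal (𝓞 K)),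
      T.card ≤ (a * Fintype.card ι + 1) * Module.finrank ℚ K * N ∧
      (n ≠ 0 → (∀ i, |n i| ≤ N) →
        ∀ P : Ideal (𝓞 K), P.IsPrime → P ≠ ⊥ → monomialDiff α n ∈ P → P ∈ T) := by
    by_cases hn : n ≠ 0 ∧ ∀ i, |n i| ≤ N
    · have hnorm := absNorm_span_singleton_le_two_pow (monomialDiff α n)
        (a * N * Fintype.card ι + 1) fun σ ↦ by
          have hσ := map_monomialDiff ((σ : K →+* ℂ).comp (algebraMap (𝓞 K) K)) α n
          exact (congrArg norm hσ).trans_le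
            (norm_monomialDiff_le _ a N (fun i ↦ ha (σ, i)) n hn.2)
      obtain ⟨T, hT, hmem⟩ := exists_finset_primes_mem (hα n hn.1) hnorm
      refine ⟨T, hT.trans ?_, fun _ _ ↦ hmem⟩
      calc (a * N * Fintype.card ι + 1) * Module.finrank ℚ K
          ≤ (a * N * Fintype.card ι + N) * Module.finrank ℚ K := by gcongr; omega
        _ = (a * Fintype.card ι + 1) * Module.finrank ℚ K * N := by ring
    · exact ⟨∅, by simp, fun h₁ h₂ ↦ (hn ⟨h₁, h₂⟩).elim⟩
  choose T hT hmem using hprimes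
  refine ⟨(Fintype.piFinset fun _ : ι ↦ Finset.Icc (-(N : ℤ)) N).biUnion T, ?_, ?_⟩
  · refine (Finset.card_biUnion_le_card_mul _ _ _ fun n _ ↦ hT n).trans_eq ?_
    congr 1
    rw [Fintype.card_piFinset, Finset.prod_const, Finset.card_univ, Int.card_Icc]
    congr 1
    omega
  · intro P hP hbot n hn hbound hmemP
    refine Finset.mem_biUnion.mpr ⟨n, ?_, hmem n hn hbound P hP hbot hmemP⟩
    simpa [Fintype.mem_piFinset, abs_le] using hbound

/-- Let `K` be a number field with ring of integers `𝓞 K`, and `α₁, …, α_k` nonzero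
multiplicatively independent integers of `K`.  Then there is a constant `C > 0` such that
for every real `y ≥ 1`, the set of nonzero prime ideals `P` of `𝓞 K` avoiding the `αᵢ`
for which the subgroup of `(𝓞 K ⧸ P)ˣ` generated by the images of the `αᵢ` has fewer than
`y` elements is finite of cardinality at most `C·y^{1 + 1/k}`. -/
theorem stmt_15 (K : Type*) [Field K] [NumberField K]
    (k : ℕ) (hk : 0 < k) (α : Fin k → 𝓞 K) (hα : ∀ i, α i ≠ 0)
    (hind : ∀ n : Fin k → ℤ, ∏ i, ((α i : K) ^ n i) = 1 → ∀ i, n i = 0) :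
    ∃ C : ℝ, 0 < C ∧ ∀ y : ℝ, 1 ≤ y →
      {P : Ideal (𝓞 K) | P.IsPrime ∧ P ≠ ⊥ ∧ (∀ i, α i ∉ P) ∧
        (Nat.card (Subgroup.closure
            {x : (𝓞 K ⧸ P)ˣ | ∃ i, (x : 𝓞 K ⧸ P) = Ideal.Quotient.mk P (α i)}) : ℝ)
          < y}.Finite ∧
      (Nat.card {P : Ideal (𝓞 K) | P.IsPrime ∧ P ≠ ⊥ ∧ (∀ i, α i ∉ P) ∧
        (Nat.card (Subgroup.closure
            {x : (𝓞 K ⧸ P)ˣ | ∃ i, (x : 𝓞 K ⧸ P) = Ideal.Quotient.mk P (α i)}) : ℝ)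
          < y} : ℝ) ≤ C * y ^ (1 + 1 / (k : ℝ)) := by
  obtain ⟨c, hc⟩ := exists_finset_primes_monomialDiff_mem α
    fun n hn ↦ monomialDiff_ne_zero α hα hind hn
  refine ⟨6 ^ k * (c * 2) + 1, by positivity, fun y hy ↦ ?_⟩
  have hy0 : 0 ≤ y := zero_le_one.trans hy
  set t : ℝ := y ^ (k : ℝ)⁻¹
  have ht1 : 1 ≤ t := Real.one_le_rpow hy (by positivity)
  have htk : t ^ k = y := Real.rpow_inv_natCast_pow hy0 hk.ne'
  have hN : t ≤ (⌈t⌉₊ : ℝ) := Nat.le_ceil t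
  have hN2 : (⌈t⌉₊ : ℝ) ≤ 2 * t := by linarith [Nat.ceil_lt_add_one (zero_le_one.trans ht1)]
  obtain ⟨T, hT, hmem⟩ := hc ⌈t⌉₊ (Nat.ceil_pos.mpr (by linarith))
  rw [Fintype.card_fin] at hT
  set S : Set (Ideal (𝓞 K)) := {P : Ideal (𝓞 K) | P.IsPrime ∧ P ≠ ⊥ ∧ (∀ i, α i ∉ P) ∧
    (Nat.card (Subgroup.closure
      {x : (𝓞 K ⧸ P)ˣ | ∃ i, (x : 𝓞 K ⧸ P) = Ideal.Quotient.mk P (α i)}) : ℝ) < y}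
  have hS : S ⊆ T := by
    rintro P ⟨hP, hbot, hαP, hcard⟩
    have hlt : Nat.card (Subgroup.closure
        {x : (𝓞 K ⧸ P)ˣ | ∃ i, (x : 𝓞 K ⧸ P) = Ideal.Quotient.mk P (α i)}) <
        ⌈t⌉₊ ^ Fintype.card (Fin k) := by
      rw [Fintype.card_fin, ← Nat.cast_lt (α := ℝ), Nat.cast_pow]
      refine hcard.trans_le ?_
      rw [← htk]
      gcongr
    obtain ⟨n, hn, hbound, hnP⟩ := exists_monomialDiff_mem α hP hbot hαP hlt
    exact hmem P hP hbot n hn hbound hnP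
  refine ⟨T.finite_toSet.subset hS, ?_⟩
  have hcardS : Nat.card S ≤ T.card := by
    simpa using Nat.card_mono T.finite_toSet hS
  have hyt : y ^ (1 + 1 / (k : ℝ)) = t ^ k * t := by
    rw [htk, Real.rpow_add (by linarith), Real.rpow_one, one_div]
  calc (Nat.card S : ℝ) ≤ ((2 * ⌈t⌉₊ + 1) ^ k * (c * ⌈t⌉₊) : ℝ) := by
        exact_mod_cast hcardS.trans hT
    _ ≤ (6 * t) ^ k * (c * (2 * t)) := by
        gcongr
        linarith
    _ = 6 ^ k * (c * 2) * (t ^ k * t) := by rw [mul_pow]; ring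
    _ ≤ (6 ^ k * (c * 2) + 1) * y ^ (1 + 1 / (k : ℝ)) := by
        rw [hyt]
        gcongr
        linarith
end

section
/- Let δ > 0 and let a₁, …, a₇ be nonzero integers that are multiplicatively independent. Then there exists a constant C > 0 such that for all real x ≥ 2, the number of primes p ≤ x with p ∤ a₁·a₂···a₇ and such that the subgroup of (ℤ/pℤ)ˣ generated by the residues of a₁, …, a₇ has cardinality at most x^{7/8 − δ}, is at most C·x^{1 − 8δ/7}. -/
open scoped Classical

/-- A positive integer `n` has at most `log₂ n` distinct prime factors. -/
theorem two_pow_card_primeFactors_le {n : ℕ} (hn : n ≠ 0) : 2 ^ n.primeFactors.card ≤ n :=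
  calc 2 ^ n.primeFactors.card ≤ ∏ p ∈ n.primeFactors, p :=
        Finset.pow_card_le_prod _ _ _ (fun _ hp => (Nat.prime_of_mem_primeFactors hp).two_le)
    _ ≤ n := Nat.le_of_dvd (Nat.pos_of_ne_zero hn) (Nat.prod_primeFactors_dvd n)

section PowDifference

variable {ι : Type*} [Fintype ι]

/-- The difference of the numerator and the denominator of `∏ i, a i ^ z i`, where the factors with
positive exponent make up the numerator and those with negative exponent the denominator. -/
def powDifference (a z : ι → ℤ) : ℤ :=
  ∏ i, a i ^ (z i).toNat - ∏ i, a i ^ (-z i).toNat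

theorem prod_zpow_eq_one_of_powDifference_eq_zero {a z : ι → ℤ} (ha : ∀ i, a i ≠ 0)
    (h : powDifference a z = 0) : ∏ i, (a i : ℚ) ^ z i = 1 := by
  have hz : ∀ i, (a i : ℚ) ^ z i = (a i : ℚ) ^ (z i).toNat / (a i : ℚ) ^ (-z i).toNat := by
    intro i
    rw [← zpow_natCast, ← zpow_natCast, ← zpow_sub₀ (Int.cast_ne_zero.mpr (ha i))]
    congr 1
    omega
  have hne : ∏ i, (a i : ℚ) ^ (-z i).toNat ≠ 0 :=
    Finset.prod_ne_zero_iff.mpr fun i _ => pow_ne_zero _ (Int.cast_ne_zero.mpr (ha i))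
  simp_rw [hz, Finset.prod_div_distrib]
  rw [div_eq_one_iff_eq hne]
  exact_mod_cast sub_eq_zero.mp h

theorem natAbs_prod_pow_le {a : ι → ℤ} (ha : ∀ i, a i ≠ 0) {e : ι → ℕ} {N : ℕ}
    (he : ∀ i, e i ≤ N) : (∏ i, a i ^ e i).natAbs ≤ (∏ i, a i).natAbs ^ N := by
  rw [← Int.natAbs_pow, ← Finset.prod_pow, ← Int.natAbsHom_apply, ← Int.natAbsHom_apply, map_prod,
    map_prod]
  refine Finset.prod_le_prod' fun i _ => ?_
  simp only [Int.natAbsHom_apply, Int.natAbs_pow]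
  exact Nat.pow_le_pow_right (Int.natAbs_pos.mpr (ha i)) (he i)

theorem natAbs_powDifference_le {a z : ι → ℤ} (ha : ∀ i, a i ≠ 0) {N : ℕ}
    (hz : ∀ i, z i ∈ Finset.Icc (-N : ℤ) N) :
    (powDifference a z).natAbs ≤ 2 ^ (1 + (∏ i, a i).natAbs * N) := by
  have hpos : ∀ i, (z i).toNat ≤ N := fun i => by have := Finset.mem_Icc.mp (hz i); omega
  have hneg : ∀ i, (-z i).toNat ≤ N := fun i => by have := Finset.mem_Icc.mp (hz i); omega
  calc (powDifference a z).natAbs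
      ≤ (∏ i, a i ^ (z i).toNat).natAbs + (∏ i, a i ^ (-z i).toNat).natAbs :=
        Int.natAbs_sub_le _ _
    _ ≤ (∏ i, a i).natAbs ^ N + (∏ i, a i).natAbs ^ N :=
        add_le_add (natAbs_prod_pow_le ha hpos) (natAbs_prod_pow_le ha hneg)
    _ = 2 * (∏ i, a i).natAbs ^ N := (two_mul _).symm
    _ ≤ 2 * (2 ^ (∏ i, a i).natAbs) ^ N := by gcongr; exact Nat.lt_two_pow_self.le
    _ = 2 ^ (1 + (∏ i, a i).natAbs * N) := by rw [pow_add, pow_one, pow_mul]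

theorem card_primeFactors_powDifference_le {a z : ι → ℤ} (ha : ∀ i, a i ≠ 0) {N : ℕ}
    (hz : ∀ i, z i ∈ Finset.Icc (-N : ℤ) N) (h : powDifference a z ≠ 0) :
    (powDifference a z).natAbs.primeFactors.card ≤ 1 + (∏ i, a i).natAbs * N :=
  (Nat.pow_le_pow_iff_right one_lt_two).mp <|
    (two_pow_card_primeFactors_le (Int.natAbs_ne_zero.mpr h)).trans (natAbs_powDifference_le ha hz)

/-- Pigeonhole: if the residues of the `a i` generate a group with fewer than `(N + 1) ^ |ι|`
elements, then `p` divides some `powDifference a z` with `0 < max |z i| ≤ N`. -/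
theorem exists_dvd_powDifference {p : ℕ} (hp : p.Prime) {a : ι → ℤ}
    (hpa : ¬ (p : ℤ) ∣ ∏ i, a i) {N : ℕ}
    (hcard : Nat.card (Subgroup.closure {u : (ZMod p)ˣ | ∃ i, (u : ZMod p) = (a i : ZMod p)})
      < (N + 1) ^ Fintype.card ι) :
    ∃ z : ι → ℤ, z ≠ 0 ∧ (∀ i, z i ∈ Finset.Icc (-N : ℤ) N) ∧
      (p : ℤ) ∣ powDifference a z := by
  have : Fact p.Prime := ⟨hp⟩
  have ha : ∀ i, (a i : ZMod p) ≠ 0 := by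
    rw [← ZMod.intCast_zmod_eq_zero_iff_dvd, Int.cast_prod] at hpa
    exact fun i => Finset.prod_ne_zero_iff.mp hpa i (Finset.mem_univ i)
  set G := Subgroup.closure {u : (ZMod p)ˣ | ∃ i, (u : ZMod p) = (a i : ZMod p)}
  let u : ι → G := fun i => ⟨Units.mk0 _ (ha i), Subgroup.subset_closure ⟨i, rfl⟩⟩
  let f : (ι → Fin (N + 1)) → G := fun m => ∏ i, u i ^ (m i : ℕ)
  have hf : ¬ Function.Injective f := fun hinj => by
    have := Nat.card_le_card_of_injective f hinj
    rw [Nat.card_fun, Nat.card_fin, Nat.card_eq_fintype_card] at this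
    exact this.not_gt hcard
  obtain ⟨m, n, hmn, hne⟩ := Function.not_injective_iff.mp hf
  refine ⟨fun i => (m i : ℤ) - n i, fun h => hne ?_, fun i => ?_, ?_⟩
  · ext i
    have := congrFun h i
    simp only [Pi.zero_apply] at this
    omega
  · simp only [Finset.mem_Icc]
    omega
  · have hval : ∏ i, (a i : ZMod p) ^ (m i : ℕ) = ∏ i, (a i : ZMod p) ^ (n i : ℕ) := by
      simpa [f, u] using congrArg (fun g : G => ((g : (ZMod p)ˣ) : ZMod p)) hmn
    have hsplit : ∀ s t : ι → Fin (N + 1), ∏ i, (a i : ZMod p) ^ (s i : ℕ) =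
        (∏ i, (a i : ZMod p) ^ ((s i : ℤ) - t i).toNat) *
          ∏ i, (a i : ZMod p) ^ (min (s i : ℕ) (t i)) := by
      intro s t
      rw [← Finset.prod_mul_distrib]
      refine Finset.prod_congr rfl fun i _ => ?_
      rw [← pow_add]
      congr 1
      omega
    rw [hsplit m n, hsplit n m] at hval
    simp_rw [min_comm (n _ : ℕ)] at hval
    have hcancel := mul_right_cancel₀
      (Finset.prod_ne_zero_iff.mpr fun i _ => pow_ne_zero _ (ha i)) hval
    rw [← ZMod.intCast_zmod_eq_zero_iff_dvd, powDifference]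
    push_cast
    simpa [sub_eq_zero] using hcancel

/-- A set of primes modulo each of which the multiplicatively independent integers `a i` generate a
group with fewer than `(N + 1) ^ |ι|` elements is bounded in size in terms of `N`. -/
theorem card_primes_card_closure_lt_le {a : ι → ℤ} (ha : ∀ i, a i ≠ 0)
    (hind : ∀ n : ι → ℤ, ∏ i, ((a i : ℚ) ^ n i) = 1 → ∀ i, n i = 0) (N : ℕ) (S : Finset ℕ)
    (hS : ∀ p ∈ S, p.Prime ∧ ¬ (p : ℤ) ∣ ∏ i, a i ∧
      Nat.card (Subgroup.closure {u : (ZMod p)ˣ | ∃ i, (u : ZMod p) = (a i : ZMod p)})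
        < (N + 1) ^ Fintype.card ι) :
    S.card ≤ (2 * N + 1) ^ Fintype.card ι * (1 + (∏ i, a i).natAbs * N) := by
  let box : Finset (ι → ℤ) := Fintype.piFinset fun _ => Finset.Icc (-N : ℤ) N
  have hbox : box.card = (2 * N + 1) ^ Fintype.card ι := by
    rw [Fintype.card_piFinset, Finset.prod_const, Finset.card_univ, Int.card_Icc]
    congr 1
    omega
  have hnz : ∀ z : ι → ℤ, z ≠ 0 → powDifference a z ≠ 0 := fun z hz h =>
    hz (funext (hind z (prod_zpow_eq_one_of_powDifference_eq_zero ha h)))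
  have hsub : S ⊆ (box.erase 0).biUnion fun z => (powDifference a z).natAbs.primeFactors := by
    intro p hpS
    obtain ⟨hp, hpa, hcard⟩ := hS p hpS
    obtain ⟨z, hz, hzN, hdvd⟩ := exists_dvd_powDifference hp hpa hcard
    exact Finset.mem_biUnion.mpr ⟨z, Finset.mem_erase.mpr ⟨hz, Fintype.mem_piFinset.mpr hzN⟩,
      Nat.mem_primeFactors.mpr
        ⟨hp, Int.natCast_dvd.mp hdvd, Int.natAbs_ne_zero.mpr (hnz z hz)⟩⟩
  calc S.card ≤ _ := Finset.card_le_card hsub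
    _ ≤ (box.erase 0).card * (1 + (∏ i, a i).natAbs * N) := by
        refine Finset.card_biUnion_le_card_mul _ _ _ fun z hz => ?_
        obtain ⟨hz0, hzN⟩ := Finset.mem_erase.mp hz
        exact card_primeFactors_powDifference_le ha (Fintype.mem_piFinset.mp hzN) (hnz z hz0)
    _ ≤ box.card * (1 + (∏ i, a i).natAbs * N) := by
        gcongr
        exact Finset.erase_subset _ _
    _ = _ := by rw [hbox]

end PowDifference

/-- Let `δ > 0` and let `a₁, …, a₇` be nonzero multiplicatively independent integers.
Then there is a constant `C > 0` such that for all real `x ≥ 2`, the number of primes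
`p ≤ x` with `p ∤ a₁⋯a₇` for which the subgroup of `(ℤ/pℤ)ˣ` generated by the residues of
the `aᵢ` has at most `x^{7/8 - δ}` elements is at most `C·x^{1 - 8δ/7}`. -/
theorem stmt_17 (δ : ℝ) (hδ : 0 < δ) (a : Fin 7 → ℤ) (ha : ∀ i, a i ≠ 0)
    (hind : ∀ n : Fin 7 → ℤ, ∏ i, ((a i : ℚ) ^ n i) = 1 → ∀ i, n i = 0) :
    ∃ C : ℝ, 0 < C ∧ ∀ x : ℝ, 2 ≤ x →
      (((Finset.range (⌊x⌋₊ + 1)).filter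
          (fun p : ℕ => p.Prime ∧ ¬ ((p : ℤ) ∣ ∏ i, a i) ∧
            (Nat.card (Subgroup.closure
                {u : (ZMod p)ˣ | ∃ i, (u : ZMod p) = ((a i : ℤ) : ZMod p)}) : ℝ)
              ≤ x ^ ((7:ℝ)/8 - δ))).card : ℝ)
        ≤ C * x ^ (1 - 8 * δ / 7) := by
  set A := (∏ i, a i).natAbs
  refine ⟨3 ^ 7 * (1 + A), by positivity, fun x hx => ?_⟩
  have hx0 : 0 < x := by linarith
  set y := x ^ ((7 : ℝ) / 8 - δ) with hy
  have hy0 : 0 < y := Real.rpow_pos_of_pos hx0 _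
  set N := ⌊y ^ (1 / 7 : ℝ)⌋₊
  have hNle : (N : ℝ) ≤ y ^ (1 / 7 : ℝ) := Nat.floor_le (by positivity)
  have hlt : y < ((N + 1 : ℕ) : ℝ) ^ 7 := by
    calc y = (y ^ (1 / 7 : ℝ)) ^ 7 := by
          rw [← Real.rpow_mul_natCast hy0.le]; norm_num
      _ < _ := by
          gcongr
          exact_mod_cast Nat.lt_floor_add_one (y ^ (1 / 7 : ℝ))
  rcases lt_or_ge y 1 with hy1 | hy1
  · rw [Finset.filter_false_of_mem, Finset.card_empty, Nat.cast_zero]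
    · positivity
    · rintro p - ⟨hp, -, hcard⟩
      have : Fact p.Prime := ⟨hp⟩
      have := hcard.trans_lt hy1
      norm_cast at this
      exact Nat.card_pos.ne' (Nat.lt_one_iff.mp this)
  have hN1 : (1 : ℝ) ≤ N :=
    Nat.one_le_cast.mpr (Nat.le_floor (by simpa using Real.one_le_rpow hy1 (by norm_num)))
  refine (Nat.cast_le.mpr (card_primes_card_closure_lt_le ha hind N _ fun p hp => ?_)).trans ?_
  · obtain ⟨hp, hpa, hcard⟩ := (Finset.mem_filter.mp hp).2
    exact ⟨hp, hpa, by exact_mod_cast hcard.trans_lt hlt⟩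
  calc (((2 * N + 1) ^ Fintype.card (Fin 7) * (1 + A * N) : ℕ) : ℝ)
      = (2 * N + 1 : ℝ) ^ 7 * (1 + A * N) := by push_cast [Fintype.card_fin]; rfl
    _ ≤ (3 * N : ℝ) ^ 7 * (N + A * N) := by gcongr; linarith
    _ = 3 ^ 7 * (1 + A) * (N : ℝ) ^ 8 := by ring
    _ ≤ 3 ^ 7 * (1 + A) * (y ^ (1 / 7 : ℝ)) ^ 8 := by gcongr
    _ = 3 ^ 7 * (1 + A) * x ^ (1 - 8 * δ / 7) := by
        rw [hy, ← Real.rpow_mul_natCast (by positivity), ← Real.rpow_mul hx0.le]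
        congr 2
        push_cast
        ring
end
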